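/- arXiv:1811.10539 — 2 statements merged into one kernel-verified Lean document; each statement's English description precedes it below -/
import Mathlib

section
/- Let K be a field, n > 1 an integer, and b, c ∈ K nonzero elements. Let g ∈ K[x, y] be a polynomial such that every monomial x^i y^j occurring in g satisfies i ≤ n, j ≤ n−1, and (n−1)·i + n·j < n(n−1). Then the polynomial b·x^n + c·y^{n−1} + g is irreducible in K[x, y]. -/
open Polynomial in
/-- The algebra homomorphism `X i ↦ X i * t ^ w i`, whose `t`-degree is the weighted degree. -/
noncomputable def weightHom {K : Type*} [CommSemiring K] {σ : Type*} (w : σ → ℕ) :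
    MvPolynomial σ K →ₐ[K] (MvPolynomial σ K)[X] :=
  MvPolynomial.aeval fun i => Polynomial.C (MvPolynomial.X i) * Polynomial.X ^ w i

section weightHom

variable {K : Type*} {σ : Type*}

theorem eval_one_weightHom [CommSemiring K] (w : σ → ℕ) (p : MvPolynomial σ K) :
    (weightHom w p).eval 1 = p := by
  have h : ((Polynomial.aeval (1 : MvPolynomial σ K)).restrictScalars K).comp (weightHom w)
      = AlgHom.id K (MvPolynomial σ K) := by
    ext i; simp [weightHom]
  simpa using DFunLike.congr_fun h p

theorem eval_zero_weightHom [CommSemiring K] {w : σ → ℕ} (hw : ∀ i, w i ≠ 0)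
    (p : MvPolynomial σ K) :
    (weightHom w p).eval 0 = MvPolynomial.C (MvPolynomial.constantCoeff p) := by
  have h : ((Polynomial.aeval (0 : MvPolynomial σ K)).restrictScalars K).comp (weightHom w)
      = (Algebra.ofId K (MvPolynomial σ K)).comp (MvPolynomial.aeval fun _ => (0 : K)) := by
    ext i; simp [weightHom, hw]
  simpa [Algebra.ofId_apply] using DFunLike.congr_fun h p

theorem weightHom_ne_zero [CommSemiring K] (w : σ → ℕ) {p : MvPolynomial σ K} (hp : p ≠ 0) :
    weightHom w p ≠ 0 := by
  intro h
  apply hp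
  rw [← eval_one_weightHom w p, h, Polynomial.eval_zero]

theorem isUnit_of_natDegree_weightHom_eq_zero [Field K] {w : σ → ℕ} (hw : ∀ i, w i ≠ 0)
    {p : MvPolynomial σ K} (hp : p ≠ 0) (h : (weightHom w p).natDegree = 0) : IsUnit p := by
  have hC : p = MvPolynomial.C (MvPolynomial.constantCoeff p) := by
    have h1 := eval_one_weightHom w p
    have h0 := eval_zero_weightHom hw p
    rw [Polynomial.eq_C_of_natDegree_eq_zero h, Polynomial.eval_C] at h0 h1
    exact h1.symm.trans h0
  rw [hC]
  refine (IsUnit.mk0 _ fun h0 => hp ?_).map MvPolynomial.C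
  rw [hC, h0, map_zero]

theorem natDegree_weightHom_le [CommSemiring K] (w : σ → ℕ) {p : MvPolynomial σ K} {d : ℕ}
    (h : ∀ m ∈ p.support, m.sum (fun i k => w i * k) ≤ d) : (weightHom w p).natDegree ≤ d := by
  rw [weightHom, MvPolynomial.aeval_def, MvPolynomial.eval₂_eq]
  refine Polynomial.natDegree_sum_le_of_forall_le _ _ fun m hm => ?_
  have e : (∏ i ∈ m.support, (Polynomial.C (MvPolynomial.X (R := K) i) * Polynomial.X ^ w i) ^ m i)
      = Polynomial.C (∏ i ∈ m.support, MvPolynomial.X i ^ m i)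
        * Polynomial.X ^ (m.sum fun i k => w i * k) := by
    simp_rw [mul_pow, Finset.prod_mul_distrib, ← pow_mul, Finset.prod_pow_eq_pow_sum, map_prod,
      map_pow]
    rfl
  rw [e, Polynomial.algebraMap_apply, ← mul_assoc, ← Polynomial.C_mul]
  exact (Polynomial.natDegree_C_mul_X_pow_le _ _).trans (h m hm)

/-- Restricting a polynomial to the `i`-th coordinate axis. -/
noncomputable def axisHom [CommSemiring K] [DecidableEq σ] (i : σ) :
    MvPolynomial σ K →ₐ[K] Polynomial K :=
  MvPolynomial.aeval (Pi.single i Polynomial.X)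

theorem map_weightHom [CommSemiring K] [DecidableEq σ] (w : σ → ℕ) (i : σ)
    (p : MvPolynomial σ K) :
    (weightHom w p).map (MvPolynomial.aeval (Pi.single i 1 : σ → K)).toRingHom
      = Polynomial.expand K (w i) (axisHom i p) := by
  have h : (Polynomial.mapAlgHom (MvPolynomial.aeval (Pi.single i 1 : σ → K))).comp (weightHom w)
      = (Polynomial.expand K (w i)).comp (axisHom i) := by
    ext1 j
    obtain rfl | hj := eq_or_ne j i
    · simp [weightHom, axisHom]
    · simp [weightHom, axisHom, hj]
  exact DFunLike.congr_fun h p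

theorem natDegree_axisHom_mul_le [CommSemiring K] [DecidableEq σ] (w : σ → ℕ) (i : σ)
    (p : MvPolynomial σ K) :
    (axisHom i p).natDegree * w i ≤ (weightHom w p).natDegree := by
  rw [← Polynomial.natDegree_expand, ← map_weightHom]
  exact Polynomial.natDegree_map_le

theorem degree_axisHom_lt [CommSemiring K] [DecidableEq σ] {i : σ} {p : MvPolynomial σ K} {d : ℕ}
    (h : ∀ m ∈ p.support, m i < d) : (axisHom i p).degree < d := by
  rw [axisHom, MvPolynomial.aeval_def, MvPolynomial.eval₂_eq, ← Polynomial.mem_degreeLT]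
  refine Submodule.sum_mem _ fun m hm => ?_
  rw [Polynomial.mem_degreeLT, Polynomial.algebraMap_eq]
  by_cases hs : ∃ j ∈ m.support, j ≠ i
  · obtain ⟨j, hj, hji⟩ := hs
    rw [Finset.prod_eq_zero hj (by simp [hji, Finsupp.mem_support_iff.mp hj]), mul_zero,
      Polynomial.degree_zero]
    exact WithBot.bot_lt_coe d
  · push Not at hs
    rw [Finset.prod_subset (s₂ := {i}) (fun j hj => Finset.mem_singleton.mpr (hs j hj))
      (fun j _ hj => by simp [Finsupp.notMem_support_iff.mp hj]), Finset.prod_singleton,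
      Pi.single_eq_same]
    exact (Polynomial.degree_C_mul_X_pow_le _ _).trans_lt (by exact_mod_cast h m hm)

theorem natDegree_axisHom_eq [Field K] [DecidableEq σ] {i j : σ} (hij : i ≠ j) {b c : K}
    (hb : b ≠ 0) {d e : ℕ} (he : e ≠ 0) {g : MvPolynomial σ K} (h : ∀ m ∈ g.support, m i < d) :
    (axisHom i (MvPolynomial.C b * MvPolynomial.X i ^ d + MvPolynomial.C c * MvPolynomial.X j ^ e
      + g)).natDegree = d := by
  have hX : axisHom i (MvPolynomial.C b * MvPolynomial.X i ^ d
      + MvPolynomial.C c * MvPolynomial.X j ^ e : MvPolynomial σ K)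
      = Polynomial.C b * Polynomial.X ^ d := by
    simp [axisHom, hij.symm, he]
  have hd : (Polynomial.C b * Polynomial.X ^ d).degree = (d : WithBot ℕ) :=
    Polynomial.degree_C_mul_X_pow d hb
  rw [map_add, hX]
  refine Polynomial.natDegree_eq_of_degree_eq_some ?_
  rw [Polynomial.degree_add_eq_left_of_degree_lt, hd]
  exact hd ▸ degree_axisHom_lt h

/-- If the restriction of a product to a coordinate axis attains the weighted degree of the
product, then the same holds for each factor. -/
theorem natDegree_axisHom_mul_eq_of_mul [Field K] [DecidableEq σ] {w : σ → ℕ} {i : σ}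
    {p q : MvPolynomial σ K} (h0 : axisHom i (p * q) ≠ 0)
    (h : (weightHom w (p * q)).natDegree ≤ (axisHom i (p * q)).natDegree * w i) :
    (axisHom i p).natDegree * w i = (weightHom w p).natDegree ∧
      (axisHom i q).natDegree * w i = (weightHom w q).natDegree := by
  have hp := natDegree_axisHom_mul_le w i p
  have hq := natDegree_axisHom_mul_le w i q
  have hp0 : p ≠ 0 := by rintro rfl; simp at h0
  have hq0 : q ≠ 0 := by rintro rfl; simp at h0
  rw [map_mul] at h0
  rw [map_mul, map_mul, Polynomial.natDegree_mul (weightHom_ne_zero w hp0)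
    (weightHom_ne_zero w hq0), Polynomial.natDegree_mul (left_ne_zero_of_mul h0)
    (right_ne_zero_of_mul h0), add_mul] at h
  omega

end weightHom

/-- **Weighted-homogeneity irreducibility criterion.**
Let `K` be a field, `n > 1`, and `b, c ∈ K` nonzero. Give the monomial
`x ^ i * y ^ j` the weight `(n-1) * i + n * j`. If every monomial of
`g ∈ K[x, y]` has `i ≤ n`, `j ≤ n - 1`, and weight strictly less than
`n * (n - 1)` (the common weight of `x ^ n` and `y ^ (n-1)`), then
`b * x ^ n + c * y ^ (n-1) + g` is irreducible in `K[x, y]`. -/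
theorem weighted_leading_irreducible
    (K : Type) [Field K] (n : ℕ) (hn : 1 < n) (b c : K) (hb : b ≠ 0) (hc : c ≠ 0)
    (g : MvPolynomial (Fin 2) K)
    (hg : ∀ m ∈ g.support,
      m 0 ≤ n ∧ m 1 ≤ n - 1 ∧ (n - 1) * m 0 + n * m 1 < n * (n - 1)) :
    Irreducible
      (MvPolynomial.C b * (MvPolynomial.X 0 : MvPolynomial (Fin 2) K) ^ n
        + MvPolynomial.C c * (MvPolynomial.X 1) ^ (n - 1) + g) := by
  set f := MvPolynomial.C b * (MvPolynomial.X 0 : MvPolynomial (Fin 2) K) ^ n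
    + MvPolynomial.C c * (MvPolynomial.X 1) ^ (n - 1) + g with hf
  let w : Fin 2 → ℕ := ![n - 1, n]
  have hw : ∀ i, w i ≠ 0 := by
    intro i
    fin_cases i <;> simp [w] <;> omega
  have hx : (axisHom 0 f).natDegree = n :=
    natDegree_axisHom_eq (by decide) hb (by omega) fun m hm => by
      have := (hg m hm).2.2
      by_contra! hle
      nlinarith [Nat.mul_le_mul_left (n - 1) hle]
  have hy : (axisHom 1 f).natDegree = n - 1 := by
    rw [hf, add_comm (MvPolynomial.C b * _)]
    exact natDegree_axisHom_eq (by decide) hc (by omega) fun m hm => by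
      have := (hg m hm).2.2
      by_contra! hle
      nlinarith [Nat.mul_le_mul_left n hle]
  have hwf : (weightHom w f).natDegree ≤ n * (n - 1) := by
    have hg' : (weightHom w g).natDegree ≤ n * (n - 1) :=
      natDegree_weightHom_le w fun m hm => by
        rw [Finsupp.sum_fintype _ _ (by simp), Fin.sum_univ_two]
        exact (hg m hm).2.2.le
    have hX (a : K) (i : Fin 2) (d : ℕ) (hd : w i * d = n * (n - 1)) :
        (weightHom w (MvPolynomial.C a * MvPolynomial.X i ^ d)).natDegree ≤ n * (n - 1) := by
      rw [MvPolynomial.C_mul_X_pow_eq_monomial]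
      refine natDegree_weightHom_le w fun m hm => ?_
      rw [Finset.mem_singleton.mp (MvPolynomial.support_monomial_subset hm),
        Finsupp.sum_single_index (mul_zero _), hd]
    rw [hf, map_add, map_add]
    exact Polynomial.natDegree_add_le_of_degree_le (Polynomial.natDegree_add_le_of_degree_le
      (hX b 0 n (mul_comm _ _)) (hX c 1 (n - 1) rfl)) hg'
  have hx0 : axisHom 0 f ≠ 0 := Polynomial.ne_zero_of_natDegree_gt (n := 0) (by omega)
  have hy0 : axisHom 1 f ≠ 0 := Polynomial.ne_zero_of_natDegree_gt (n := 0) (by omega)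
  refine ⟨fun hu => ?_, fun p q hpq => ?_⟩
  · have := Polynomial.natDegree_eq_zero_of_isUnit (hu.map (axisHom 0))
    omega
  · have hx' : (weightHom w f).natDegree ≤ (axisHom 0 f).natDegree * w 0 := by rwa [hx]
    have hy' : (weightHom w f).natDegree ≤ (axisHom 1 f).natDegree * w 1 := by
      rw [hy, mul_comm]; exact hwf
    have hp0 : p ≠ 0 := by rintro rfl; simp [hpq] at hx0
    have hq0 : q ≠ 0 := by rintro rfl; simp [hpq] at hx0
    rw [hpq] at hx hx0 hy0 hx' hy'
    obtain ⟨hpx, hqx⟩ := natDegree_axisHom_mul_eq_of_mul hx0 hx'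
    obtain ⟨hpy, -⟩ := natDegree_axisHom_mul_eq_of_mul hy0 hy'
    rw [map_mul] at hx hx0
    rw [Polynomial.natDegree_mul (left_ne_zero_of_mul hx0) (right_ne_zero_of_mul hx0)] at hx
    have hdvd : n ∣ (axisHom 0 p).natDegree := by
      have hcop : Nat.Coprime n (n - 1) :=
        (Nat.coprime_self_sub_right hn.le).mpr (Nat.coprime_one_right n)
      refine hcop.dvd_of_dvd_mul_right ⟨(axisHom 1 p).natDegree, ?_⟩
      rw [mul_comm n]
      exact hpx.trans hpy.symm
    obtain h | h := Nat.eq_zero_or_pos (axisHom 0 p).natDegree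
    · exact .inl (isUnit_of_natDegree_weightHom_eq_zero hw hp0 (by rw [← hpx, h, zero_mul]))
    · have := Nat.le_of_dvd h hdvd
      have h' : (axisHom 0 q).natDegree = 0 := by omega
      exact .inr (isUnit_of_natDegree_weightHom_eq_zero hw hq0 (by rw [← hqx, h', zero_mul]))
end

section
/- Let n > 1 be an integer, p a prime not dividing n(n−1), q a power of p, and A = 𝔽_q[t]. For d ∈ ℕ let N(d) be the number of tuples (a_1, …, a_n) ∈ A^n with deg(a_i) ≤ i·d for all i such that the discriminant disc(x^n + a_1 x^{n−1} + ⋯ + a_n) ∈ A is a squarefree element of A, and let D(d) = q^{n + d·n(n+1)/2} be the total number of such tuples. Then the limit lim_{d→∞} N(d)/D(d) exists and is strictly positive. -/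
open Polynomial

/-- The Sylvester matrix of two polynomials `p`, `q`, of size
`(p.natDegree + q.natDegree) × (p.natDegree + q.natDegree)`:
the first `q.natDegree` rows contain the shifted coefficients of `p`,
the remaining `p.natDegree` rows the shifted coefficients of `q`. -/
noncomputable def sylvesterMatrix {R : Type*} [CommRing R] (p q : R[X]) :
    Matrix (Fin (p.natDegree + q.natDegree)) (Fin (p.natDegree + q.natDegree)) R :=
  Matrix.of fun i j =>
    if (i : ℕ) < q.natDegree then
      if (i : ℕ) ≤ (j : ℕ) ∧ (j : ℕ) ≤ (i : ℕ) + p.natDegree then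
        p.coeff (p.natDegree + i - j)
      else 0
    else
      if (i : ℕ) - q.natDegree ≤ (j : ℕ) ∧ (j : ℕ) ≤ (i : ℕ) then
        q.coeff (q.natDegree + ((i : ℕ) - q.natDegree) - j)
      else 0

/-- The resultant `Res(p, q)` of two polynomials, as the determinant of their
Sylvester matrix. -/
noncomputable def polyRes {R : Type*} [CommRing R] (p q : R[X]) : R :=
  (sylvesterMatrix p q).det

/-- The discriminant of a (monic) polynomial `f` of degree `N`:
`disc f = (-1) ^ (N * (N - 1) / 2) * Res (f, f')`. -/
noncomputable def polyDisc {R : Type*} [CommRing R] (f : R[X]) : R :=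
  (-1) ^ (f.natDegree * (f.natDegree - 1) / 2) * polyRes f (derivative f)


/-! ### Densities of subsets of finite types -/

/-- The proportion of elements of a finite type lying in `S`. -/
noncomputable def setDensity {X : Type*} (S : Set X) : ℝ := (S.ncard : ℝ) / Nat.card X

lemma setDensity_nonneg {X : Type*} (S : Set X) : 0 ≤ setDensity S := by
  unfold setDensity; positivity

lemma setDensity_mono {X : Type*} [Finite X] {S T : Set X} (h : S ⊆ T) :
    setDensity S ≤ setDensity T := by
  unfold setDensity
  gcongr
  exact Set.toFinite T

lemma setDensity_empty {X : Type*} : setDensity (∅ : Set X) = 0 := by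
  simp [setDensity]

lemma setDensity_union_le {X : Type*} (S T : Set X) :
    setDensity (S ∪ T) ≤ setDensity S + setDensity T := by
  unfold setDensity
  rw [← add_div]
  gcongr
  exact_mod_cast Set.ncard_union_le S T

lemma setDensity_biUnion_le {X ι : Type*} (s : Finset ι) (S : ι → Set X) :
    setDensity (⋃ i ∈ s, S i) ≤ ∑ i ∈ s, setDensity (S i) := by
  classical
  induction s using Finset.induction_on with
  | empty => simp [setDensity_empty]
  | insert a s ha ih =>
    rw [Finset.set_biUnion_insert, Finset.sum_insert ha]
    exact (setDensity_union_le _ _).trans (by gcongr)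

lemma setDensity_compl {X : Type*} [Finite X] [Nonempty X] (S : Set X) :
    setDensity Sᶜ = 1 - setDensity S := by
  have hX : (Nat.card X : ℝ) ≠ 0 := by exact_mod_cast Nat.card_pos.ne'
  have h : (S.ncard : ℝ) + (Sᶜ).ncard = Nat.card X := by
    exact_mod_cast Set.ncard_add_ncard_compl S
  unfold setDensity
  field_simp
  linarith

lemma setDensity_univ_pi {ι : Type*} [Fintype ι] {X : ι → Type*} [∀ i, Finite (X i)]
    (S : ∀ i, Set (X i)) :
    setDensity (Set.univ.pi S) = ∏ i, setDensity (S i) := by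
  unfold setDensity
  rw [Finset.prod_div_distrib, ← Nat.card_coe_set_eq, Nat.card_congr (Equiv.Set.univPi S),
    Nat.card_pi, Nat.card_pi]
  simp [Nat.card_coe_set_eq]

lemma ncard_preimage_of_surjective {G H : Type*} [AddCommGroup G] [AddCommGroup H]
    (f : G →+ H) (hf : Function.Surjective f) (S : Set H) :
    (f ⁻¹' S).ncard = Nat.card f.ker * S.ncard := by
  obtain ⟨σ, hσ⟩ := hf.hasRightInverse
  have hσ' : ∀ h, f (σ h) = h := hσ
  let e : (f ⁻¹' S) ≃ f.ker × S :=
    { toFun := fun g => (⟨g - σ (f g), by simp [AddMonoidHom.mem_ker, hσ']⟩, ⟨f g, g.2⟩)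
      invFun := fun x => ⟨x.1 + σ x.2, by
        have := x.1.2
        rw [AddMonoidHom.mem_ker] at this
        simp [this, hσ']⟩
      left_inv := fun g => by simp
      right_inv := fun x => by
        have := x.1.2
        rw [AddMonoidHom.mem_ker] at this
        ext <;> simp [this, hσ'] }
  rw [← Nat.card_coe_set_eq, Nat.card_congr e, Nat.card_prod, Nat.card_coe_set_eq]

lemma setDensity_preimage {G H : Type*} [AddCommGroup G] [AddCommGroup H] [Finite G]
    (f : G →+ H) (hf : Function.Surjective f) (S : Set H) :
    setDensity (f ⁻¹' S) = setDensity S := by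
  have h := ncard_preimage_of_surjective f hf Set.univ
  rw [Set.preimage_univ, Set.ncard_univ, Set.ncard_univ] at h
  have hk : (Nat.card f.ker : ℝ) ≠ 0 := by exact_mod_cast Nat.card_pos.ne'
  unfold setDensity
  rw [ncard_preimage_of_surjective f hf S, h]
  push_cast
  exact mul_div_mul_left _ _ hk

lemma ncard_eq_sum_boole {X : Type*} [Fintype X] [DecidableEq X] (S : Set X)
    [DecidablePred (· ∈ S)] : (S.ncard : ℝ) = ∑ x, if x ∈ S then 1 else 0 := by
  rw [Set.ncard_eq_toFinset_card', Finset.sum_boole]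
  congr 2
  ext; simp

/-- Bounding a density by averaging over the translates along `φ : H → G`. -/
lemma setDensity_le_of_translate {G H : Type*} [AddCommGroup G] [Finite G] [Finite H] [Nonempty H]
    (φ : H → G) (S T : Set G) (c : ℝ)
    (hT : ∀ g ∈ T, setDensity {h | g + φ h ∈ S} ≤ c) (hT' : ∀ g ∉ T, ∀ h, g + φ h ∉ S) :
    setDensity S ≤ c * setDensity T := by
  classical
  have := Fintype.ofFinite G
  have := Fintype.ofFinite H
  have hH : (0 : ℝ) < Nat.card H := by exact_mod_cast Nat.card_pos
  have hG : (0 : ℝ) < Nat.card G := by exact_mod_cast Nat.card_pos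
  have h1 : ∑ g : G, (({h | g + φ h ∈ S} : Set H).ncard : ℝ) = Nat.card H * S.ncard := by
    simp only [ncard_eq_sum_boole, Set.mem_ofPred_eq]
    rw [Finset.sum_comm]
    have : ∀ h : H, (∑ g : G, if g + φ h ∈ S then (1 : ℝ) else 0) =
        ∑ g : G, if g ∈ S then (1 : ℝ) else 0 := fun h =>
      Equiv.sum_comp (Equiv.addRight (φ h)) (fun g => if g ∈ S then (1 : ℝ) else 0)
    rw [Finset.sum_congr rfl fun h _ => this h]
    simp
  have h2 : ∑ g : G, (({h | g + φ h ∈ S} : Set H).ncard : ℝ) ≤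
      ∑ g : G, c * Nat.card H * (if g ∈ T then 1 else 0) := by
    refine Finset.sum_le_sum fun g _ => ?_
    by_cases hg : g ∈ T
    · have := hT g hg
      unfold setDensity at this
      rw [div_le_iff₀ hH] at this
      simpa [hg] using this
    · simp [hg, hT' g hg]
  rw [h1, ← Finset.mul_sum, ← ncard_eq_sum_boole] at h2
  unfold setDensity
  rw [← mul_div_assoc]
  gcongr
  nlinarith

lemma setDensity_le_of_forall_translate {G H : Type*} [AddCommGroup G] [Finite G] [Finite H]
    [Nonempty H] (φ : H → G) (S : Set G) (c : ℝ)
    (hT : ∀ g, setDensity {h | g + φ h ∈ S} ≤ c) : setDensity S ≤ c := by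
  have h := setDensity_le_of_translate φ S Set.univ c (fun g _ => hT g) (by simp)
  have : setDensity (Set.univ : Set G) = 1 := by
    have hX : (Nat.card G : ℝ) ≠ 0 := by exact_mod_cast Nat.card_pos.ne'
    simp [setDensity, Set.ncard_univ, hX]
  rwa [this, mul_one] at h

lemma setDensity_le_div {X : Type*} (S : Set X) {r : ℕ} (h : S.ncard ≤ r) :
    setDensity S ≤ (r : ℝ) / Nat.card X := by
  unfold setDensity
  gcongr

/-! ### Reduction of polynomials of bounded degree -/

lemma natCard_degreeLT (F : Type*) [Field F] (N : ℕ) :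
    Nat.card (degreeLT F N) = Nat.card F ^ N := by
  rw [Nat.card_congr (degreeLTEquiv F N).toEquiv, Nat.card_fun]
  simp

instance finite_degreeLT (F : Type*) [Field F] [Finite F] (N : ℕ) : Finite (degreeLT F N) :=
  Finite.of_equiv _ (degreeLTEquiv F N).symm.toEquiv

lemma Polynomial.Monic.finite_of_adjoinRoot {F : Type*} [Field F] [Finite F] {m : F[X]}
    (hm : m.Monic) : Finite (AdjoinRoot m) :=
  have := hm.finite_adjoinRoot
  Module.finite_of_finite F

lemma Polynomial.Monic.natCard_adjoinRoot {F : Type*} [Field F] {m : F[X]}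
    (hm : m.Monic) : Nat.card (AdjoinRoot m) = Nat.card F ^ m.natDegree := by
  rw [Nat.card_congr (AdjoinRoot.powerBasis' hm).basis.equivFun.toEquiv, Nat.card_fun]
  simp

lemma finite_coe_degreeLT (F : Type*) [Field F] [Finite F] (N : ℕ) :
    (degreeLT F N : Set F[X]).Finite :=
  Set.finite_coe_iff.1 (finite_degreeLT F N)

/-- The monic irreducible polynomials of degree `m`. -/
def monicIrreducibles (F : Type*) [Field F] (m : ℕ) : Set F[X] :=
  {π | π.Monic ∧ Irreducible π ∧ π.natDegree = m}

lemma injOn_eraseLead_monicIrreducibles (F : Type*) [Field F] (m : ℕ) :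
    Set.InjOn (fun π : F[X] => π - X ^ m) (monicIrreducibles F m) :=
  fun _ _ _ _ h => sub_left_injective h

lemma mapsTo_monicIrreducibles (F : Type*) [Field F] (m : ℕ) :
    Set.MapsTo (fun π : F[X] => π - X ^ m) (monicIrreducibles F m) (degreeLT F m : Set F[X]) := by
  rintro π ⟨h1, -, rfl⟩
  simp only [SetLike.mem_coe, mem_degreeLT]
  rw [← degree_eq_natDegree h1.ne_zero]
  exact degree_sub_lt_left (by simp [degree_eq_natDegree h1.ne_zero]) h1.ne_zero (by simp [h1.leadingCoeff])

lemma finite_monicIrreducibles (F : Type*) [Field F] [Finite F] (m : ℕ) :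
    (monicIrreducibles F m).Finite :=
  Set.Finite.of_injOn (mapsTo_monicIrreducibles F m) (injOn_eraseLead_monicIrreducibles F m)
    (finite_coe_degreeLT F m)

lemma ncard_monicIrreducibles_le (F : Type*) [Field F] [Finite F] (m : ℕ) :
    (monicIrreducibles F m).ncard ≤ Nat.card F ^ m := by
  rw [← natCard_degreeLT, ← SetLike.coe_sort_coe, Nat.card_coe_set_eq]
  exact Set.ncard_le_ncard_of_injOn _ (mapsTo_monicIrreducibles F m)
    (injOn_eraseLead_monicIrreducibles F m) (finite_coe_degreeLT F m)

/-- Tuples `(g, y)` of polynomials with `deg (g i) ≤ w i * d` and `deg y ≤ v * d`. -/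
abbrev PolyBox (F : Type*) [Field F] {k : ℕ} (w : Fin k → ℕ) (v d : ℕ) : Type _ :=
  (∀ i, degreeLT F (w i * d + 1)) × degreeLT F (v * d + 1)

/-- Reduction of a box of polynomials modulo `m`. -/
noncomputable def PolyBox.reduce {F : Type*} [Field F] {k : ℕ} (w : Fin k → ℕ) (v d : ℕ)
    (m : F[X]) : PolyBox F w v d →+ (Fin k → AdjoinRoot m) × AdjoinRoot m where
  toFun b := (fun i => AdjoinRoot.mk m (b.1 i), AdjoinRoot.mk m b.2)
  map_zero' := by ext <;> simp
  map_add' a b := by ext <;> simp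

lemma exists_degreeLT_of_crt {F : Type*} [Field F] {ι : Type*} [Fintype ι] (m : ι → F[X])
    (hm : ∀ i, (m i).Monic) (hco : Pairwise fun i j => IsCoprime (m i) (m j)) {N : ℕ}
    (hN : (∏ i, m i).natDegree ≤ N) (x : ∀ i, AdjoinRoot (m i)) :
    ∃ a : degreeLT F N, ∀ i, AdjoinRoot.mk (m i) a = x i := by
  choose z hz using fun i => AdjoinRoot.mk_surjective (x i)
  obtain ⟨r, hr⟩ := Ideal.exists_forall_sub_mem_ideal (I := fun i => Ideal.span {m i})
    (fun i j hij => (Ideal.isCoprime_span_singleton_iff _ _).2 (hco hij)) z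
  have hM : (∏ i, m i).Monic := monic_prod_of_monic _ _ fun i _ => hm i
  refine ⟨⟨r %ₘ ∏ i, m i, ?_⟩, fun i => ?_⟩
  · rw [mem_degreeLT]
    refine (degree_modByMonic_lt _ hM).trans_le ?_
    rw [degree_eq_natDegree hM.ne_zero]
    exact_mod_cast hN
  · rw [← hz i, AdjoinRoot.mk_eq_mk]
    have h1 : m i ∣ r - z i := Ideal.mem_span_singleton.1 (hr i)
    have h2 : m i ∣ r %ₘ (∏ i, m i) - r := by
      rw [modByMonic_eq_sub_mul_div, sub_sub_cancel_left]
      exact ((Finset.dvd_prod_of_mem m (Finset.mem_univ i)).mul_right _).neg_right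
    have := dvd_add h2 h1
    simpa using this

lemma PolyBox.reduce_pi_surjective {F : Type*} [Field F] {k : ℕ} {w : Fin k → ℕ} {v d : ℕ}
    (hw : ∀ i, 0 < w i) (hv : 0 < v) {ι : Type*} [Fintype ι] (m : ι → F[X])
    (hm : ∀ i, (m i).Monic) (hco : Pairwise fun i j => IsCoprime (m i) (m j))
    (hN : (∏ i, m i).natDegree ≤ d) :
    Function.Surjective (AddMonoidHom.pi fun i => PolyBox.reduce w v d (m i)) := by
  intro x
  have h1 : ∀ j, (∏ i, m i).natDegree ≤ w j * d + 1 := fun j => by nlinarith [hw j]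
  have h2 : (∏ i, m i).natDegree ≤ v * d + 1 := by nlinarith
  choose a ha using fun j => exists_degreeLT_of_crt m hm hco (h1 j) (fun i => (x i).1 j)
  obtain ⟨b, hb⟩ := exists_degreeLT_of_crt m hm hco h2 (fun i => (x i).2)
  refine ⟨(a, b), ?_⟩
  funext i
  ext j
  · exact ha j i
  · exact hb i

lemma PolyBox.reduce_surjective {F : Type*} [Field F] {k : ℕ} {w : Fin k → ℕ} {v d : ℕ}
    (hw : ∀ i, 0 < w i) (hv : 0 < v) {m : F[X]} (hm : m.Monic) (hN : m.natDegree ≤ d) :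
    Function.Surjective (PolyBox.reduce w v d m) := by
  intro x
  obtain ⟨a, ha⟩ := PolyBox.reduce_pi_surjective hw hv (fun _ : Unit => m) (fun _ => hm)
    (fun i j h => (h rfl).elim) (by simpa using hN) (fun _ => x)
  exact ⟨a, congrFun ha ()⟩

/-! ### Evaluation of a polynomial with generic coefficients -/

/-- The specialization of `P` at the parameters `g`. -/
noncomputable def specialize {F : Type*} [Field F] {k : ℕ} (P : (MvPolynomial (Fin k) F)[X])
    {R : Type*} [CommRing R] [Algebra F R] (g : Fin k → R) : R[X] :=
  P.map (MvPolynomial.aeval g).toRingHom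

/-- The value of `P` at `(g, y)`. -/
noncomputable def evalAt {F : Type*} [Field F] {k : ℕ} (P : (MvPolynomial (Fin k) F)[X])
    {R : Type*} [CommRing R] [Algebra F R] (x : (Fin k → R) × R) : R :=
  (specialize P x.1).eval x.2

lemma specialize_comp {F : Type*} [Field F] {k : ℕ} (P : (MvPolynomial (Fin k) F)[X])
    {R S : Type*} [CommRing R] [Algebra F R] [CommRing S] [Algebra F S] (φ : R →ₐ[F] S)
    (g : Fin k → R) : specialize P (fun i => φ (g i)) = (specialize P g).map φ.toRingHom := by
  unfold specialize
  rw [Polynomial.map_map]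
  congr 1
  ext i <;> simp

lemma evalAt_comp {F : Type*} [Field F] {k : ℕ} (P : (MvPolynomial (Fin k) F)[X])
    {R S : Type*} [CommRing R] [Algebra F R] [CommRing S] [Algebra F S] (φ : R →ₐ[F] S)
    (x : (Fin k → R) × R) : evalAt P (fun i => φ (x.1 i), φ x.2) = φ (evalAt P x) := by
  unfold evalAt
  rw [specialize_comp]
  exact Polynomial.eval_map_apply ..

/-- A Schwartz–Zippel bound for boxes whose sides have at least `N` elements. -/
lemma setDensity_aeval_eq_zero_le {F : Type*} [Field F] {k : ℕ} {Δ : MvPolynomial (Fin k) F}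
    (hΔ : Δ ≠ 0) {R : Type*} [CommRing R] [IsDomain R] [Algebra F R] {G : Fin k → Type*}
    [∀ i, Finite (G i)] (ι : ∀ i, G i → R) (hι : ∀ i, Function.Injective (ι i)) {N : ℕ}
    (hN : 0 < N) (hG : ∀ i, N ≤ Nat.card (G i)) :
    setDensity {x : ∀ i, G i | MvPolynomial.aeval (fun i => ι i (x i)) Δ = 0} ≤
      ((∑ i, Δ.degreeOf i : ℕ) : ℝ) / N := by
  classical
  have (i : Fin k) : Fintype (G i) := Fintype.ofFinite _
  let S : Fin k → Finset R := fun i => Finset.univ.image (ι i)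
  have hS : ∀ i, (S i).card = Nat.card (G i) := fun i => by
    simp [S, Finset.card_image_of_injective _ (hι i)]
  let Δ' := MvPolynomial.map (algebraMap F R) Δ
  have hinj := FaithfulSMul.algebraMap_injective F R
  have hΔ' : Δ' ≠ 0 := by
    simpa [Δ'] using (map_ne_zero_iff _ (MvPolynomial.map_injective _ hinj)).2 hΔ
  have hev : ∀ x : Fin k → R, MvPolynomial.eval x Δ' = MvPolynomial.aeval x Δ := fun x => by
    simp [Δ', MvPolynomial.eval_map, MvPolynomial.aeval_def]
  have hsz := MvPolynomial.schwartz_zippel_sum_degreeOf hΔ' S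
  have h1 : ({x : ∀ i, G i | MvPolynomial.aeval (fun i => ι i (x i)) Δ = 0}).ncard ≤
      (Finset.filter (fun x => MvPolynomial.eval x Δ' = 0) (Fintype.piFinset S)).card := by
    rw [← Set.ncard_coe_finset]
    refine Set.ncard_le_ncard_of_injOn (fun x i => ι i (x i)) ?_ ?_ (Finset.finite_toSet _)
    · intro x hx
      simpa [S, hev] using hx
    · intro x _ y _ h
      funext i
      exact hι i (congrFun h i)
  have h2 : (∑ i, (Δ'.degreeOf i : ℚ≥0) / (S i).card) ≤ ((∑ i, Δ.degreeOf i : ℕ) : ℚ≥0) / N := by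
    push_cast
    rw [Finset.sum_div]
    refine Finset.sum_le_sum fun i _ => ?_
    gcongr
    · exact MvPolynomial.degreeOf_le_iff.2 fun s hs => MvPolynomial.degreeOf_le_iff.1 le_rfl s
        (MvPolynomial.support_map_subset _ _ hs)
    · rw [hS]; exact hG i
  have h3 := hsz.trans h2
  have h4 : ((Finset.card (Finset.filter (fun x => MvPolynomial.eval x Δ' = 0)
      (Fintype.piFinset S)) : ℝ)) / (∏ i, ((S i).card : ℝ)) ≤ ((∑ i, Δ.degreeOf i : ℕ) : ℝ) / N := by
    have h5 := (NNRat.cast_le (K := ℝ)).2 h3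
    push_cast at h5 ⊢
    exact h5
  refine le_trans ?_ h4
  unfold setDensity
  rw [Nat.card_pi]
  push_cast
  simp only [hS]
  gcongr

section Specialize

variable {F : Type*} [Field F] {k : ℕ} {P : (MvPolynomial (Fin k) F)[X]}

lemma specialize_monic (hP : P.Monic) {R : Type*} [CommRing R] [Algebra F R] (g : Fin k → R) :
    (specialize P g).Monic := hP.map _

lemma natDegree_specialize (hP : P.Monic) {R : Type*} [CommRing R] [Nontrivial R] [Algebra F R]
    (g : Fin k → R) : (specialize P g).natDegree = P.natDegree := hP.natDegree_map _

lemma specialize_bezout {Δ : MvPolynomial (Fin k) F} {U V : (MvPolynomial (Fin k) F)[X]}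
    (h : U * P + V * derivative P = C Δ) {R : Type*} [CommRing R] [Algebra F R] (g : Fin k → R) :
    specialize U g * specialize P g + specialize V g * derivative (specialize P g) =
      C (MvPolynomial.aeval g Δ) := by
  unfold specialize
  rw [derivative_map, ← Polynomial.map_mul, ← Polynomial.map_mul, ← Polynomial.map_add, h]
  simp

lemma ncard_roots_specialize_le (hP : P.Monic) {R : Type*} [CommRing R] [IsDomain R] [Algebra F R]
    (g : Fin k → R) : {y | (specialize P g).eval y = 0}.ncard ≤ P.natDegree := by
  classical
  rw [← natDegree_specialize hP g]
  have : {y | (specialize P g).eval y = 0} = ((specialize P g).roots.toFinset : Set R) := by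
    ext y
    simp [(specialize_monic hP g).ne_zero]
  rw [this, Set.ncard_coe_finset]
  exact (Multiset.toFinset_card_le _).trans (card_roots' _)

/-- Two roots modulo a square-zero ideal which agree modulo that ideal are equal, provided the
discriminant-like quantity `Δ` is a unit. -/
lemma eq_of_eval_eq_zero_of_sub_sq_eq_zero {Δ : MvPolynomial (Fin k) F}
    {U V : (MvPolynomial (Fin k) F)[X]} (h : U * P + V * derivative P = C Δ)
    {R : Type*} [CommRing R] [Algebra F R] (g : Fin k → R)
    (hu : IsUnit (MvPolynomial.aeval g Δ)) {y z : R} (hy : (specialize P g).eval y = 0)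
    (hz : (specialize P g).eval z = 0) (hyz : (z - y) ^ 2 = 0) : y = z := by
  have h1 := congrArg (eval y) (specialize_bezout h g)
  simp only [eval_add, eval_mul, hy, mul_zero, zero_add, eval_C] at h1
  obtain ⟨c, hc⟩ := Polynomial.binomExpansion (specialize P g) y (z - y)
  rw [add_sub_cancel, hz, hy, hyz, mul_zero, add_zero, zero_add] at hc
  have h2 : MvPolynomial.aeval g Δ * (z - y) = 0 := by
    rw [← h1, mul_assoc, ← hc, mul_zero]
  exact (sub_eq_zero.1 (hu.mul_right_eq_zero.1 h2)).symm

end Specialize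

/-- The reduction map `F[X]/(π²) → F[X]/(π)`. -/
noncomputable def reduceSq {F : Type*} [Field F] (π : F[X]) :
    AdjoinRoot (π ^ 2) →ₐ[F] AdjoinRoot π :=
  AdjoinRoot.algHomOfDvd F (π ^ 2) π (dvd_pow_self π two_ne_zero)

lemma reduceSq_mk {F : Type*} [Field F] (π a : F[X]) :
    reduceSq π (AdjoinRoot.mk _ a) = AdjoinRoot.mk _ a := by
  rw [← AdjoinRoot.aeval_eq, ← AdjoinRoot.aeval_eq, ← Polynomial.aeval_algHom_apply]
  simp [reduceSq]

lemma reduceSq_surjective {F : Type*} [Field F] (π : F[X]) : Function.Surjective (reduceSq π) := by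
  intro x
  obtain ⟨a, rfl⟩ := AdjoinRoot.mk_surjective x
  exact ⟨_, reduceSq_mk π a⟩

lemma sq_eq_zero_of_reduceSq {F : Type*} [Field F] {π : F[X]} {x : AdjoinRoot (π ^ 2)}
    (hx : reduceSq π x = 0) : x ^ 2 = 0 := by
  obtain ⟨a, rfl⟩ := AdjoinRoot.mk_surjective x
  rw [reduceSq_mk, AdjoinRoot.mk_eq_zero] at hx
  rw [← map_pow, AdjoinRoot.mk_eq_zero]
  exact pow_dvd_pow_of_dvd hx 2

lemma isUnit_of_reduceSq_ne_zero {F : Type*} [Field F] {π : F[X]} (hπ : Irreducible π)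
    {x : AdjoinRoot (π ^ 2)} (hx : reduceSq π x ≠ 0) : IsUnit x := by
  obtain ⟨a, rfl⟩ := AdjoinRoot.mk_surjective x
  rw [reduceSq_mk, Ne, AdjoinRoot.mk_eq_zero] at hx
  obtain ⟨u, v, huv⟩ := ((hπ.coprime_iff_not_dvd).2 hx).pow_left (m := 2)
  refine IsUnit.of_mul_eq_one (AdjoinRoot.mk _ v) ?_
  have := congrArg (AdjoinRoot.mk (π ^ 2)) huv
  simpa [mul_comm] using this

/-- The density of the tuples modulo `π²` at which `P` vanishes. -/
noncomputable def localDensity {F : Type*} [Field F] {k : ℕ} (P : (MvPolynomial (Fin k) F)[X])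
    (π : F[X]) : ℝ :=
  setDensity {x : (Fin k → AdjoinRoot (π ^ 2)) × AdjoinRoot (π ^ 2) | evalAt P x = 0}

lemma localDensity_le {F : Type*} [Field F] [Finite F] {k : ℕ} {P : (MvPolynomial (Fin k) F)[X]}
    (hP : P.Monic) {Δ : MvPolynomial (Fin k) F} (hΔ : Δ ≠ 0)
    {U V : (MvPolynomial (Fin k) F)[X]} (hB : U * P + V * derivative P = C Δ)
    {π : F[X]} (hπm : π.Monic) (hπ : Irreducible π) :
    localDensity P π ≤ (P.natDegree * (1 + ∑ i, Δ.degreeOf i) : ℕ) /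
      ((Nat.card F : ℝ) ^ π.natDegree) ^ 2 := by
  have : Fact (Irreducible π) := ⟨hπ⟩
  have hf2 : Finite (AdjoinRoot (π ^ 2)) := (hπm.pow 2).finite_of_adjoinRoot
  have hf1 : Finite (AdjoinRoot π) := hπm.finite_of_adjoinRoot
  have hc2 : (Nat.card (AdjoinRoot (π ^ 2)) : ℝ) = ((Nat.card F : ℝ) ^ π.natDegree) ^ 2 := by
    rw [(hπm.pow 2).natCard_adjoinRoot, hπm.natDegree_pow, mul_comm, pow_mul]
    push_cast
    rfl
  have hc1 : (Nat.card (AdjoinRoot π) : ℝ) = (Nat.card F : ℝ) ^ π.natDegree := by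
    rw [hπm.natCard_adjoinRoot]
    push_cast
    rfl
  have hpos : 0 < Nat.card (AdjoinRoot π) := Nat.card_pos
  let ρ : (Fin k → AdjoinRoot (π ^ 2)) × AdjoinRoot (π ^ 2) →+
      (Fin k → AdjoinRoot π) × AdjoinRoot π :=
    { toFun := fun x => (fun i => reduceSq π (x.1 i), reduceSq π x.2)
      map_zero' := by ext <;> simp
      map_add' := fun a b => by ext <;> simp }
  have hρ : Function.Surjective ρ := by
    rintro ⟨g, y⟩
    choose a ha using fun i => reduceSq_surjective π (g i)
    obtain ⟨b, hb⟩ := reduceSq_surjective π y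
    exact ⟨(a, b), Prod.ext (funext ha) hb⟩
  let S1 : Set ((Fin k → AdjoinRoot (π ^ 2)) × AdjoinRoot (π ^ 2)) :=
    {x | evalAt P x = 0 ∧ reduceSq π (MvPolynomial.aeval x.1 Δ) ≠ 0}
  let S2 : Set ((Fin k → AdjoinRoot π) × AdjoinRoot π) :=
    {x | evalAt P x = 0 ∧ MvPolynomial.aeval x.1 Δ = 0}
  have hsub : {x : (Fin k → AdjoinRoot (π ^ 2)) × AdjoinRoot (π ^ 2) | evalAt P x = 0} ⊆
      S1 ∪ ρ ⁻¹' S2 := by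
    intro x hx
    by_cases h : reduceSq π (MvPolynomial.aeval x.1 Δ) = 0
    · right
      refine ⟨?_, ?_⟩
      · change evalAt P (fun i => reduceSq π (x.1 i), reduceSq π x.2) = 0
        rw [evalAt_comp, show evalAt P x = 0 from hx, map_zero]
      · change MvPolynomial.aeval (fun i => reduceSq π (x.1 i)) Δ = 0
        rw [← h]
        exact (MvPolynomial.comp_aeval_apply (f := x.1) (reduceSq π) Δ).symm
    · exact Or.inl ⟨hx, h⟩
  have hS1 : setDensity S1 ≤ (P.natDegree : ℝ) / Nat.card (AdjoinRoot (π ^ 2)) := by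
    refine setDensity_le_of_forall_translate (H := AdjoinRoot (π ^ 2)) (fun y => (0, y)) _ _
      fun x => setDensity_le_div _ ?_
    refine (Set.ncard_le_ncard_of_injOn (fun y => reduceSq π (x.2 + y)) ?_ ?_ (Set.toFinite _)).trans
      (ncard_roots_specialize_le hP (fun i => reduceSq π (x.1 i)))
    · rintro y ⟨hy, -⟩
      have h1 := evalAt_comp P (reduceSq π) (x + (0, y))
      rw [hy, map_zero] at h1
      simpa [evalAt] using h1
    · rintro y ⟨hy, hy'⟩ z ⟨hz, -⟩ hyz
      simp only [evalAt, Prod.fst_add, add_zero, Prod.snd_add] at hy hy' hz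
      refine add_left_cancel (eq_of_eval_eq_zero_of_sub_sq_eq_zero hB x.1
        (isUnit_of_reduceSq_ne_zero hπ hy') hy hz (sq_eq_zero_of_reduceSq ?_))
      rw [map_sub, sub_eq_zero]
      exact hyz.symm
  have hT : setDensity {x : (Fin k → AdjoinRoot π) × AdjoinRoot π | MvPolynomial.aeval x.1 Δ = 0} ≤
      ((∑ i, Δ.degreeOf i : ℕ) : ℝ) / Nat.card (AdjoinRoot π) := by
    refine le_trans (le_of_eq ?_) (setDensity_aeval_eq_zero_le hΔ (R := AdjoinRoot π)
      (G := fun _ => AdjoinRoot π) (fun _ x => x) (fun _ => Function.injective_id) hpos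
      (fun _ => le_rfl))
    exact setDensity_preimage (AddMonoidHom.fst (Fin k → AdjoinRoot π) (AdjoinRoot π))
      Prod.fst_surjective {g | MvPolynomial.aeval g Δ = 0}
  have hS2 : setDensity S2 ≤ (P.natDegree : ℝ) / Nat.card (AdjoinRoot π) *
      setDensity {x : (Fin k → AdjoinRoot π) × AdjoinRoot π | MvPolynomial.aeval x.1 Δ = 0} := by
    refine setDensity_le_of_translate (H := AdjoinRoot π) (fun y => (0, y)) _ _ _ ?_ ?_
    · intro x _
      refine setDensity_le_div _ ((Set.ncard_le_ncard_of_injOn (fun y => x.2 + y) ?_ ?_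
        (Set.toFinite _)).trans (ncard_roots_specialize_le hP x.1))
      · rintro y ⟨hy, -⟩
        simpa [evalAt] using hy
      · intro y _ z _ h
        exact add_left_cancel h
    · rintro x hx y ⟨-, hy⟩
      exact hx (by simpa using hy)
  have h := ((setDensity_mono hsub).trans (setDensity_union_le _ _)).trans
    (add_le_add hS1 ((setDensity_preimage ρ hρ S2).le.trans
      (hS2.trans (mul_le_mul_of_nonneg_left hT (by positivity)))))
  refine h.trans (le_of_eq ?_)
  have hne : (Nat.card F : ℝ) ^ π.natDegree ≠ 0 := by
    rw [← hc1]; exact_mod_cast hpos.ne'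
  rw [hc2, hc1]
  field_simp
  push_cast
  ring

/-! ### The resultant controlling square factors -/

/-- Differentiate the coefficients of a polynomial over `F[X]`. -/
noncomputable def coeffDeriv {F : Type*} [Field F] (p : F[X][X]) : F[X][X] :=
  ∑ i ∈ Finset.range (p.natDegree + 1), C (derivative (p.coeff i)) * X ^ i

lemma derivative_eval_eq {F : Type*} [Field F] (p : F[X][X]) (b : F[X]) :
    derivative (p.eval b) = (coeffDeriv p).eval b + derivative b * (derivative p).eval b := by
  rw [derivative_eval, sum_over_range _ (by simp), eval_eq_sum_range, derivative_sum, Finset.mul_sum,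
    coeffDeriv, eval_finsetSum, ← Finset.sum_add_distrib]
  refine Finset.sum_congr rfl fun i _ => ?_
  simp only [derivative_mul, derivative_pow, eval_mul, eval_C, eval_pow, eval_X]
  simp only [map_natCast]
  ring

lemma coeff_coeffDeriv {F : Type*} [Field F] (p : F[X][X]) (i : ℕ) :
    (coeffDeriv p).coeff i = derivative (p.coeff i) := by
  simp only [coeffDeriv, finsetSum_coeff, coeff_C_mul_X_pow]
  rw [Finset.sum_ite_eq]
  split_ifs with h
  · rfl
  · rw [coeff_eq_zero_of_natDegree_lt (by simpa using h), derivative_zero]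

lemma natDegree_coeffDeriv_le {F : Type*} [Field F] (p : F[X][X]) :
    (coeffDeriv p).natDegree ≤ p.natDegree := by
  refine natDegree_le_iff_coeff_eq_zero.2 fun N hN => ?_
  rw [coeff_coeffDeriv, coeff_eq_zero_of_natDegree_lt hN, derivative_zero]

/-- The total derivative of `p`, as a polynomial in `y`, when `y` has derivative `w`. -/
noncomputable def totalDeriv {F : Type*} [Field F] (p : F[X][X]) (w : F[X]) : F[X][X] :=
  coeffDeriv p + C w * derivative p

lemma natDegree_totalDeriv_le {F : Type*} [Field F] (p : F[X][X]) (w : F[X]) :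
    (totalDeriv p w).natDegree ≤ p.natDegree := by
  refine natDegree_add_le_of_degree_le (natDegree_coeffDeriv_le p) ?_
  exact (natDegree_C_mul_le _ _).trans ((natDegree_derivative_le p).trans (Nat.sub_le _ _))

lemma derivative_eval_eq_totalDeriv {F : Type*} [Field F] (p : F[X][X]) (b : F[X]) :
    derivative (p.eval b) = (totalDeriv p (derivative b)).eval b := by
  simp [derivative_eval_eq, totalDeriv]

/-- The resultant of `p` and its total derivative. -/
noncomputable def derivResultant {F : Type*} [Field F] (p : F[X][X]) (w : F[X]) : F[X] :=
  resultant p (totalDeriv p w) p.natDegree p.natDegree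

lemma dvd_derivResultant {F : Type*} [Field F] {p : F[X][X]} (hp : p.natDegree ≠ 0) {π b : F[X]}
    (h : π ^ 2 ∣ p.eval b) : π ∣ derivResultant p (derivative b) := by
  obtain ⟨u, v, -, -, huv⟩ := exists_mul_add_mul_eq_C_resultant p (totalDeriv p (derivative b))
    le_rfl (natDegree_totalDeriv_le p _) (Or.inl hp)
  have h1 := congrArg (eval b) huv
  simp only [eval_add, eval_mul, eval_C, ← derivative_eval_eq_totalDeriv] at h1
  unfold derivResultant
  rw [← h1]
  refine dvd_add (((dvd_pow_self π two_ne_zero).trans h).mul_right _) (Dvd.dvd.mul_right ?_ _)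
  obtain ⟨c, hc⟩ := h
  rw [hc, derivative_mul, derivative_pow]
  refine dvd_add (Dvd.dvd.mul_right (Dvd.dvd.mul_right (Dvd.dvd.mul_left ?_ _) _) _) ?_
  · simp
  · exact (dvd_pow_self π two_ne_zero).mul_right _

lemma natDegree_det_le_of_forall_le {R : Type*} [CommRing R] {N : ℕ} {M : Matrix (Fin N) (Fin N) R[X]}
    {B : ℕ} (hM : ∀ i j, (M i j).natDegree ≤ B) : M.det.natDegree ≤ N * B := by
  rw [Matrix.det_apply]
  refine natDegree_sum_le_of_forall_le _ _ fun σ _ => ?_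
  refine (natDegree_smul_le _ _).trans ((natDegree_prod_le _ _).trans ?_)
  refine (Finset.sum_le_card_nsmul _ _ B fun i _ => hM _ _).trans ?_
  simp

lemma natDegree_derivResultant_le {F : Type*} [Field F] {p : F[X][X]} {w : F[X]} {B : ℕ}
    (hp : ∀ i, (p.coeff i).natDegree ≤ B) (hw : w.natDegree ≤ B) :
    (derivResultant p w).natDegree ≤ 4 * p.natDegree * B := by
  have h1 : ∀ i, ((totalDeriv p w).coeff i).natDegree ≤ 2 * B := fun i => by
    rw [totalDeriv, coeff_add, coeff_C_mul, coeff_coeffDeriv, coeff_derivative]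
    refine natDegree_add_le_of_degree_le ?_ ?_
    · exact (natDegree_derivative_le _).trans ((Nat.sub_le _ _).trans ((hp i).trans (by lia)))
    · refine natDegree_mul_le.trans ?_
      have h2 : ((i : F[X]) + 1).natDegree = 0 := by
        exact_mod_cast natDegree_natCast (R := F) (i + 1)
      have := natDegree_mul_le (p := p.coeff (i + 1)) (q := (i : F[X]) + 1)
      have := hp (i + 1)
      lia
  have h3 : ∀ i j, (sylvester p (totalDeriv p w) p.natDegree p.natDegree i j).natDegree ≤ 2 * B := by
    intro i j
    induction j using Fin.addCases with
    | left j =>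
      simp only [sylvester, Matrix.of_apply, Fin.addCases_left]
      split_ifs
      · exact h1 _
      · simp
    | right j =>
      simp only [sylvester, Matrix.of_apply, Fin.addCases_right]
      split_ifs
      · exact (hp _).trans (by lia)
      · simp
  exact (natDegree_det_le_of_forall_le h3).trans (by ring_nf; rfl)

lemma not_isCoprime_of_resultant_eq_zero {K : Type*} [Field K] {p q : K[X]} (hp : p.Monic)
    (hq : q.natDegree ≤ p.natDegree) (h : resultant p q p.natDegree p.natDegree = 0) :
    ¬ IsCoprime p q := by
  obtain ⟨j, hj⟩ := Nat.exists_eq_add_of_le hq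
  have h1 := resultant_add_right_deg p q p.natDegree q.natDegree j le_rfl
  rw [← hj, h, hp.coeff_natDegree, one_pow, one_mul] at h1
  exact (resultant_eq_zero_iff.1 h1.symm).2

lemma ncard_derivResultant_eq_zero_le {F : Type*} [Field F] {p u v : F[X][X]} (hp : p.Monic)
    {δ : F[X]} (hδ : δ ≠ 0) (hB : u * p + v * derivative p = C δ) :
    {w | derivResultant p w = 0}.Finite ∧ {w | derivResultant p w = 0}.ncard ≤ p.natDegree := by
  classical
  let K := AlgebraicClosure (FractionRing F[X])
  let ι : F[X] →+* K := (algebraMap (FractionRing F[X]) K).comp (algebraMap F[X] (FractionRing F[X]))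
  have hι : Function.Injective ι :=
    (algebraMap (FractionRing F[X]) K).injective.comp (IsFractionRing.injective _ _)
  have key : ∀ w, derivResultant p w = 0 → ∃ η ∈ (p.map ι).roots.toFinset,
      (derivative (p.map ι)).eval η ≠ 0 ∧
        ((coeffDeriv p).map ι).eval η + ι w * (derivative (p.map ι)).eval η = 0 := by
    intro w hw
    have hmon : (p.map ι).Monic := hp.map ι
    have hdeg : (p.map ι).natDegree = p.natDegree := hp.natDegree_map ι
    have h2 : ¬ IsCoprime (p.map ι) ((totalDeriv p w).map ι) := by
      refine not_isCoprime_of_resultant_eq_zero hmon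
        (hdeg ▸ natDegree_map_le.trans (natDegree_totalDeriv_le p w)) ?_
      rw [hdeg, resultant_map_map]
      exact (congrArg ι hw).trans (map_zero ι)
    rw [isCoprime_iff_aeval_ne_zero_of_isAlgClosed K K] at h2
    push Not at h2
    obtain ⟨η, h3, h4⟩ := h2
    rw [coe_aeval_eq_eval] at h3 h4
    refine ⟨η, by simpa [hmon.ne_zero] using h3, fun h5 => ?_, ?_⟩
    · have h6 := congrArg (fun f : F[X][X] => (f.map ι).eval η) hB
      simp only [Polynomial.map_add, Polynomial.map_mul, eval_add, eval_mul, map_C, eval_C,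
        ← derivative_map, h3, h5, mul_zero, add_zero] at h6
      exact hδ ((map_eq_zero_iff ι hι).1 h6.symm)
    · simpa [totalDeriv, derivative_map] using h4
  choose! η hη1 hη2 hη3 using key
  have hmaps : Set.MapsTo η {w | derivResultant p w = 0} ((p.map ι).roots.toFinset : Set K) :=
    fun w hw => hη1 w hw
  have hinj : Set.InjOn η {w | derivResultant p w = 0} := by
    intro w hw z hz h
    have h1 := hη3 w hw
    have h2 := hη3 z hz
    rw [← h] at h2
    have h3 := add_left_cancel (h1.trans h2.symm)
    exact hι (mul_right_cancel₀ (hη2 w hw) h3)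
  refine ⟨Set.Finite.of_injOn hmaps hinj (Finset.finite_toSet _), ?_⟩
  refine (Set.ncard_le_ncard_of_injOn _ hmaps hinj (Finset.finite_toSet _)).trans ?_
  rw [Set.ncard_coe_finset]
  exact (Multiset.toFinset_card_le _).trans ((card_roots' _).trans natDegree_map_le)

lemma finite_monic_irreducible_dvd {F : Type*} [Field F] {R : F[X]} (hR : R ≠ 0) :
    {π : F[X] | π.Monic ∧ Irreducible π ∧ π ∣ R}.Finite ∧
      {π : F[X] | π.Monic ∧ Irreducible π ∧ π ∣ R}.ncard ≤ R.natDegree := by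
  have key : ∀ s : Finset F[X], (s : Set F[X]) ⊆ {π : F[X] | π.Monic ∧ Irreducible π ∧ π ∣ R} →
      s.card ≤ R.natDegree := by
    intro s hs
    have h1 : ∏ π ∈ s, π ∣ R := by
      refine Finset.prod_dvd_of_coprime (fun a ha b hb hab => ?_) fun π hπ => (hs hπ).2.2
      refine ((hs ha).2.1.coprime_iff_not_dvd).2 fun h => hab ?_
      exact eq_of_monic_of_associated (hs ha).1 (hs hb).1
        (((hs ha).2.1.dvd_irreducible_iff_associated (hs hb).2.1).1 h)
    have h2 := natDegree_le_of_dvd h1 hR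
    rw [natDegree_prod_of_monic _ _ fun π hπ => (hs hπ).1] at h2
    refine le_trans ?_ h2
    rw [Finset.card_eq_sum_ones]
    exact Finset.sum_le_sum fun π hπ => (hs hπ).2.1.natDegree_pos
  have hfin : {π : F[X] | π.Monic ∧ Irreducible π ∧ π ∣ R}.Finite := by
    by_contra h
    obtain ⟨s, hs, hc⟩ := Set.Infinite.exists_subset_card_eq h (R.natDegree + 1)
    have := key s hs
    lia
  refine ⟨hfin, ?_⟩
  rw [Set.ncard_eq_toFinset_card _ hfin]
  exact key _ (by simp)

/-! ### Squares of large primes -/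

lemma mem_degreeLT_succ_iff {F : Type*} [Field F] {N : ℕ} {a : F[X]} :
    a ∈ degreeLT F (N + 1) ↔ a.natDegree ≤ N := by
  rw [degreeLT_succ_eq_degreeLE, mem_degreeLE, natDegree_le_iff_degree_le]

section

variable {F : Type*} [Field F] {k : ℕ} {w : Fin k → ℕ} {v d : ℕ}

/-- The underlying polynomials of an element of a box. -/
noncomputable def PolyBox.val (x : PolyBox F w v d) : (Fin k → F[X]) × F[X] :=
  (fun i => x.1 i, x.2)

/-- Embedding of the last coordinate in a box. -/
noncomputable def PolyBox.ofSnd (w : Fin k → ℕ) (y : F[X]) (hy : y.natDegree ≤ v * d) :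
    PolyBox F w v d :=
  (0, ⟨y, mem_degreeLT_succ_iff.2 hy⟩)

lemma PolyBox.val_add_ofSnd (x : PolyBox F w v d) (y : F[X]) (hy : y.natDegree ≤ v * d) :
    (x + PolyBox.ofSnd w y hy).val = (x.val.1, x.val.2 + y) := by
  simp [PolyBox.val, PolyBox.ofSnd]

lemma PolyBox.natDegree_val_fst (x : PolyBox F w v d) (i : Fin k) :
    (x.val.1 i).natDegree ≤ w i * d := mem_degreeLT_succ_iff.1 (x.1 i).2

lemma PolyBox.natDegree_val_snd (x : PolyBox F w v d) : x.val.2.natDegree ≤ v * d :=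
  mem_degreeLT_succ_iff.1 x.2.2

lemma setDensity_degenerate_le [Finite F] (hw : ∀ i, 0 < w i)
    {Δ : MvPolynomial (Fin k) F} (hΔ : Δ ≠ 0) :
    setDensity {x : PolyBox F w v d | MvPolynomial.aeval x.val.1 Δ = 0} ≤
      ((∑ i, Δ.degreeOf i : ℕ) : ℝ) / (Nat.card F : ℝ) ^ (d + 1) := by
  have h1 := setDensity_preimage (AddMonoidHom.fst (∀ i, degreeLT F (w i * d + 1))
    (degreeLT F (v * d + 1))) Prod.fst_surjective
    {x | MvPolynomial.aeval (fun i => (x i : F[X])) Δ = 0}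
  refine (le_of_eq h1).trans ?_
  rw [← Nat.cast_pow]
  refine setDensity_aeval_eq_zero_le hΔ (fun i (x : degreeLT F (w i * d + 1)) => (x : F[X]))
    (fun i => Subtype.val_injective) (pow_pos Nat.card_pos _) fun i => ?_
  rw [natCard_degreeLT]
  exact Nat.pow_le_pow_right Nat.card_pos (by nlinarith [hw i])

lemma natDegree_pow_le_of_mem {p e : ℕ} (c : degreeLT F (e + 1)) : ((c : F[X]) ^ p).natDegree ≤ p * e :=
  natDegree_pow_le.trans (Nat.mul_le_mul_left _ (mem_degreeLT_succ_iff.1 c.2))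

variable {P : (MvPolynomial (Fin k) F)[X]}

/-- A bound for the degrees of the coefficients of the specializations of `P`. -/
noncomputable def coeffBound (P : (MvPolynomial (Fin k) F)[X]) (w : Fin k → ℕ) (v : ℕ) : ℕ :=
  (∑ i ∈ Finset.range (P.natDegree + 1), (P.coeff i).totalDegree) * (∑ i, w i) + v

lemma natDegree_coeff_specialize_le (x : PolyBox F w v d) (i : ℕ) :
    ((specialize P x.val.1).coeff i).natDegree ≤ coeffBound P w v * d := by
  unfold specialize coeffBound
  rw [coeff_map]
  by_cases hi : i ∈ Finset.range (P.natDegree + 1)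
  · refine (MvPolynomial.aeval_natDegree_le (P.coeff i) le_rfl x.val.1 (n := (∑ i, w i) * d)
      fun j => (x.natDegree_val_fst j).trans ?_).trans ?_
    · exact Nat.mul_le_mul_right _ (Finset.single_le_sum (fun _ _ => Nat.zero_le _)
        (Finset.mem_univ j))
    · have := Finset.single_le_sum (f := fun i => (P.coeff i).totalDegree)
        (fun _ _ => Nat.zero_le _) hi
      rw [← mul_assoc]
      exact Nat.mul_le_mul_right _ ((Nat.mul_le_mul_right _ this).trans (Nat.le_add_right _ _))
  · rw [coeff_eq_zero_of_natDegree_lt (by simpa using hi)]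
    simp

variable {p : ℕ} [Fact p.Prime] [CharP F p] {e : ℕ}

lemma setDensity_derivResultant_eq_zero_le [Finite F] (hv : 0 < v) (hP : P.Monic)
    {Δ : MvPolynomial (Fin k) F} {U V : (MvPolynomial (Fin k) F)[X]}
    (hB : U * P + V * derivative P = C Δ) (he : p * e + 1 ≤ d) :
    setDensity {x : PolyBox F w v d | MvPolynomial.aeval x.val.1 Δ ≠ 0 ∧
        derivResultant (specialize P x.val.1) (derivative x.val.2) = 0} ≤
      (P.natDegree : ℝ) / (Nat.card F : ℝ) ^ (e + 1) := by
  have hdeg (s : degreeLT F (e + 1)) : (X * (s : F[X]) ^ p).natDegree ≤ v * d := by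
    have h1 := natDegree_pow_le_of_mem (p := p) s
    have h2 := natDegree_mul_le (p := X) (q := (s : F[X]) ^ p)
    rw [natDegree_X] at h2
    nlinarith
  refine setDensity_le_of_forall_translate
    (fun s : degreeLT F (e + 1) => PolyBox.ofSnd w (X * (s : F[X]) ^ p) (hdeg s)) _ _ fun x => ?_
  rw [← Nat.cast_pow, ← natCard_degreeLT]
  refine setDensity_le_div _ ?_
  by_cases hx : MvPolynomial.aeval x.val.1 Δ = 0
  · simp [PolyBox.val_add_ofSnd, hx]
  have h1 := ncard_derivResultant_eq_zero_le (specialize_monic hP x.val.1) hx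
    (specialize_bezout hB x.val.1)
  rw [natDegree_specialize hP] at h1
  have hder (s : F[X]) : derivative (x.val.2 + X * s ^ p) = derivative x.val.2 + s ^ p := by
    simp [derivative_pow]
  refine (Set.ncard_le_ncard_of_injOn
    (fun s : degreeLT F (e + 1) => derivative x.val.2 + (s : F[X]) ^ p) ?_ ?_ h1.1).trans h1.2
  · rintro s ⟨-, hs⟩
    rwa [PolyBox.val_add_ofSnd, hder] at hs
  · intro s _ t _ hst
    exact Subtype.ext (frobenius_inj F[X] p (add_left_cancel hst))

lemma ncard_translate_dvd_le [Finite F] (hP : P.Monic) (g : Fin k → F[X]) (b : F[X]) {π : F[X]}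
    (hπ : Irreducible π) (he : e < π.natDegree) :
    {c : degreeLT F (e + 1) | π ∣ (specialize P g).eval (b + (c : F[X]) ^ p)}.ncard ≤
      P.natDegree := by
  have : Fact (Irreducible π) := ⟨hπ⟩
  have : CharP (AdjoinRoot π) p :=
    charP_of_injective_algebraMap (algebraMap F (AdjoinRoot π)).injective p
  have hfin : {y | (specialize P (fun i => AdjoinRoot.mkₐ (R := F) π (g i))).eval y = 0}.Finite := by
    have := (finite_setOfPred_isRoot (specialize_monic hP
      (fun i => AdjoinRoot.mkₐ (R := F) π (g i))).ne_zero)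
    exact this
  refine (Set.ncard_le_ncard_of_injOn
    (fun c : degreeLT F (e + 1) => AdjoinRoot.mkₐ (R := F) π (b + (c : F[X]) ^ p)) ?_ ?_ hfin).trans
    (ncard_roots_specialize_le hP _)
  · intro c hc
    have h1 := evalAt_comp P (AdjoinRoot.mkₐ (R := F) π) (g, b + (c : F[X]) ^ p)
    refine h1.trans ?_
    exact AdjoinRoot.mk_eq_zero.2 hc
  · intro c _ c' _ h
    simp only [map_add, map_pow] at h
    have h1 := frobenius_inj (AdjoinRoot π) p (add_left_cancel h)
    have h2 : π ∣ (c : F[X]) - c' := AdjoinRoot.mk_eq_mk.1 h1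
    refine Subtype.ext (sub_eq_zero.1 ?_)
    refine eq_zero_of_dvd_of_natDegree_lt h2 ?_
    exact (mem_degreeLT_succ_iff.1 (c - c').2).trans_lt he

lemma setDensity_large_and_derivResultant_ne_zero_le [Finite F] (hv : 0 < v) (hP : P.Monic)
    (hr : P.natDegree ≠ 0) (he : p * e + 1 ≤ d) (hed : 2 * e + 1 ≤ d) :
    setDensity {x : PolyBox F w v d |
        derivResultant (specialize P x.val.1) (derivative x.val.2) ≠ 0 ∧
        ∃ π : F[X], π.Monic ∧ Irreducible π ∧ d < 2 * π.natDegree ∧ π ^ 2 ∣ evalAt P x.val} ≤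
      ((4 * P.natDegree * (coeffBound P w v * d) * P.natDegree : ℕ) : ℝ) /
        (Nat.card F : ℝ) ^ (e + 1) := by
  have hdeg (s : degreeLT F (e + 1)) : ((s : F[X]) ^ p).natDegree ≤ v * d := by
    have h1 := natDegree_pow_le_of_mem (p := p) s
    nlinarith
  refine setDensity_le_of_forall_translate
    (fun s : degreeLT F (e + 1) => PolyBox.ofSnd w ((s : F[X]) ^ p) (hdeg s)) _ _ fun x => ?_
  rw [← Nat.cast_pow, ← natCard_degreeLT]
  refine setDensity_le_div _ ?_
  have hder (s : F[X]) : derivative (x.val.2 + s ^ p) = derivative x.val.2 := by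
    simp [derivative_pow]
  set R := derivResultant (specialize P x.val.1) (derivative x.val.2) with hR
  by_cases hR0 : R = 0
  · simp [PolyBox.val_add_ofSnd, hder, ← hR, hR0]
  have hdegR : R.natDegree ≤ 4 * P.natDegree * (coeffBound P w v * d) := by
    rw [← natDegree_specialize hP x.val.1]
    refine natDegree_derivResultant_le (natDegree_coeff_specialize_le x) ?_
    refine (natDegree_derivative_le _).trans ((Nat.sub_le _ _).trans
      (x.natDegree_val_snd.trans (Nat.mul_le_mul_right _ (Nat.le_add_left _ _))))
  obtain ⟨hfin, hcard⟩ := finite_monic_irreducible_dvd hR0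
  classical
  have hsub : {s : degreeLT F (e + 1) | x + PolyBox.ofSnd w ((s : F[X]) ^ p) (hdeg s) ∈
      {x : PolyBox F w v d |
        derivResultant (specialize P x.val.1) (derivative x.val.2) ≠ 0 ∧
        ∃ π : F[X], π.Monic ∧ Irreducible π ∧ d < 2 * π.natDegree ∧ π ^ 2 ∣ evalAt P x.val}} ⊆
      ⋃ π ∈ hfin.toFinset.filter (fun π => e < π.natDegree),
        {c : degreeLT F (e + 1) | π ∣ (specialize P x.val.1).eval (x.val.2 + (c : F[X]) ^ p)} := by
    rintro s ⟨-, π, h1, h2, h3, h4⟩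
    rw [PolyBox.val_add_ofSnd] at h4
    simp only [Set.mem_iUnion, exists_prop, Finset.mem_filter, Set.Finite.mem_toFinset]
    refine ⟨π, ⟨⟨h1, h2, ?_⟩, by lia⟩, (dvd_pow_self π two_ne_zero).trans h4⟩
    have h5 := dvd_derivResultant (by rwa [natDegree_specialize hP]) h4
    rwa [hder] at h5
  refine (Set.ncard_le_ncard hsub (Set.toFinite _)).trans ?_
  refine (Finset.set_ncard_biUnion_le _ _).trans ?_
  refine (Finset.sum_le_card_nsmul _ _ P.natDegree fun π hπ => ?_).trans ?_
  · simp only [Finset.mem_filter, Set.Finite.mem_toFinset] at hπ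
    exact ncard_translate_dvd_le hP _ _ hπ.1.2.1 hπ.2
  · rw [smul_eq_mul]
    refine Nat.mul_le_mul_right _ (((Finset.card_filter_le _ _).trans ?_).trans hdegR)
    rwa [← Set.ncard_eq_toFinset_card _ hfin]

lemma exists_setDensity_large_le [Finite F] (hw : ∀ i, 0 < w i) (hv : 0 < v) (hP : P.Monic)
    (hr : P.natDegree ≠ 0) {Δ : MvPolynomial (Fin k) F} (hΔ : Δ ≠ 0)
    {U V : (MvPolynomial (Fin k) F)[X]} (hB : U * P + V * derivative P = C Δ) :
    ∃ c : ℝ, ∀ d, 1 ≤ d → setDensity {x : PolyBox F w v d |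
        ∃ π : F[X], π.Monic ∧ Irreducible π ∧ d < 2 * π.natDegree ∧ π ^ 2 ∣ evalAt P x.val} ≤
      c * (((d - 1) / p + 1 : ℕ) / (Nat.card F : ℝ) ^ ((d - 1) / p + 1)) := by
  have hp : 2 ≤ p := (Fact.out : p.Prime).two_le
  set cΔ := ∑ i, Δ.degreeOf i with hcΔ
  set r := P.natDegree with hr'
  refine ⟨((cΔ + r + 4 * r * coeffBound P w v * p * r : ℕ) : ℝ), fun d hd => ?_⟩
  set e := (d - 1) / p with he
  have he1 : p * e + 1 ≤ d := by
    have := Nat.mul_div_le (d - 1) p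
    lia
  have he2 : 2 * e + 1 ≤ d := by nlinarith
  have he3 : d ≤ p * (e + 1) := by
    have := Nat.lt_mul_div_succ (d - 1) (show 0 < p by lia)
    lia
  have hq : (1 : ℝ) ≤ Nat.card F := by exact_mod_cast (Nat.card_pos (α := F))
  have hT0 := setDensity_degenerate_le (v := v) (d := d) hw hΔ
  have hT1 := setDensity_derivResultant_eq_zero_le (w := w) hv hP hB he1
  have hT2 := setDensity_large_and_derivResultant_ne_zero_le (w := w) hv hP hr he1 he2
  have hT0' : ((cΔ : ℕ) : ℝ) / (Nat.card F : ℝ) ^ (d + 1) ≤ cΔ / (Nat.card F : ℝ) ^ (e + 1) := by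
    gcongr
    lia
  refine (setDensity_mono (T := {x : PolyBox F w v d | MvPolynomial.aeval x.val.1 Δ = 0} ∪
    ({x : PolyBox F w v d | MvPolynomial.aeval x.val.1 Δ ≠ 0 ∧
        derivResultant (specialize P x.val.1) (derivative x.val.2) = 0} ∪
      {x : PolyBox F w v d |
        derivResultant (specialize P x.val.1) (derivative x.val.2) ≠ 0 ∧
        ∃ π : F[X], π.Monic ∧ Irreducible π ∧ d < 2 * π.natDegree ∧ π ^ 2 ∣ evalAt P x.val}))
    ?_).trans ?_
  · intro x hx
    by_cases h1 : MvPolynomial.aeval x.val.1 Δ = 0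
    · exact Or.inl h1
    · by_cases h2 : derivResultant (specialize P x.val.1) (derivative x.val.2) = 0
      · exact Or.inr (Or.inl ⟨h1, h2⟩)
      · exact Or.inr (Or.inr ⟨h2, hx⟩)
  refine (setDensity_union_le _ _).trans ((add_le_add (hT0.trans hT0')
    ((setDensity_union_le _ _).trans (add_le_add hT1 hT2))).trans ?_)
  rw [← add_div, ← add_div, ← mul_div_assoc]
  gcongr
  norm_cast
  have : 4 * r * (coeffBound P w v * d) * r ≤ 4 * r * (coeffBound P w v * (p * (e + 1))) * r := by
    gcongr
  nlinarith [Nat.zero_le (cΔ * e), Nat.zero_le (r * e)]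

end

/-! ### The sieve -/

lemma one_sub_sum_le_prod_one_sub {ι : Type*} (s : Finset ι) (f : ι → ℝ) (h0 : ∀ i ∈ s, 0 ≤ f i)
    (h1 : ∀ i ∈ s, f i ≤ 1) : 1 - ∑ i ∈ s, f i ≤ ∏ i ∈ s, (1 - f i) := by
  classical
  induction s using Finset.induction_on with
  | empty => simp
  | insert a s ha ih =>
    rw [Finset.sum_insert ha, Finset.prod_insert ha]
    have h2 := ih (fun i hi => h0 i (Finset.mem_insert_of_mem hi))
      fun i hi => h1 i (Finset.mem_insert_of_mem hi)
    have h3 : 0 ≤ ∑ i ∈ s, f i := Finset.sum_nonneg fun i hi => h0 i (Finset.mem_insert_of_mem hi)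
    have h4 := h0 a (Finset.mem_insert_self a s)
    have h5 := h1 a (Finset.mem_insert_self a s)
    nlinarith [mul_le_mul_of_nonneg_left h2 (sub_nonneg.2 h5)]

lemma tendsto_const_mul_pow_div {t : ℝ} (ht0 : 0 ≤ t) (ht1 : t < 1) (c : ℝ) :
    Filter.Tendsto (fun M : ℕ => c * (t ^ M / (1 - t))) Filter.atTop (nhds 0) := by
  simpa using ((tendsto_pow_atTop_nhds_zero_of_lt_one ht0 ht1).div_const (1 - t)).const_mul c

lemma exists_tendsto_prod_pos {b : ℕ → ℝ} {c t : ℝ} (ht0 : 0 ≤ t) (ht1 : t < 1) (hb0 : ∀ m, 0 < b m)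
    (hb1 : ∀ m, b m ≤ 1) (hb : ∀ m, 1 - c * t ^ m ≤ b m) :
    ∃ L : ℝ, 0 < L ∧ Filter.Tendsto (fun M => ∏ m ∈ Finset.range M, b m) Filter.atTop (nhds L) ∧
      ∀ M, L ≤ ∏ m ∈ Finset.range M, b m := by
  set f : ℕ → ℝ := fun M => ∏ m ∈ Finset.range M, b m with hf
  have hpos : ∀ M, 0 < f M := fun M => Finset.prod_pos fun m _ => hb0 m
  have hanti : Antitone f := antitone_nat_of_succ_le fun M => by
    rw [hf]
    simp only [Finset.prod_range_succ]
    exact mul_le_of_le_one_right (hpos M).le (hb1 M)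
  have hbdd : BddBelow (Set.range f) := ⟨0, by rintro _ ⟨M, rfl⟩; exact (hpos M).le⟩
  refine ⟨⨅ M, f M, ?_, tendsto_atTop_ciInf hanti hbdd, fun M => ciInf_le hbdd M⟩
  have hc : 0 ≤ c := by
    have h1 := hb 0
    have h2 := hb1 0
    simp only [pow_zero, mul_one] at h1
    linarith
  obtain ⟨M₀, hM₀⟩ := ((tendsto_const_mul_pow_div ht0 ht1 c).eventually_lt_const
    (show (0 : ℝ) < 1 / 2 by norm_num)).exists
  have key : ∀ M, f M₀ * (1 / 2) ≤ f M := by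
    intro M
    rcases le_total M M₀ with h | h
    · exact (mul_le_of_le_one_right (hpos _).le (by norm_num)).trans (hanti h)
    · rw [hf]
      simp only
      rw [← Finset.prod_range_mul_prod_Ico b h]
      refine mul_le_mul_of_nonneg_left ?_ (hpos _).le
      have h1 := one_sub_sum_le_prod_one_sub (Finset.Ico M₀ M) (fun m => 1 - b m)
        (fun m _ => sub_nonneg.2 (hb1 m)) (fun m _ => by linarith [hb0 m])
      simp only [sub_sub_cancel] at h1
      refine le_trans ?_ h1
      have h2 : ∑ m ∈ Finset.Ico M₀ M, (1 - b m) ≤ c * ∑ m ∈ Finset.Ico M₀ M, t ^ m := by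
        rw [Finset.mul_sum]
        exact Finset.sum_le_sum fun m _ => by linarith [hb m]
      have h3 := mul_le_mul_of_nonneg_left
        (geom_sum_Ico_le_of_lt_one (m := M₀) (n := M) ht0 ht1) hc
      linarith
  exact (mul_pos (hpos M₀) (by norm_num)).trans_le (le_ciInf key)

lemma tendsto_of_sandwich {x c τ ε : ℕ → ℝ} {L : ℝ} (hc : Filter.Tendsto c Filter.atTop (nhds L))
    (hτ : Filter.Tendsto τ Filter.atTop (nhds 0)) (hε : Filter.Tendsto ε Filter.atTop (nhds 0))
    (h1 : ∀ M, ∀ᶠ d in Filter.atTop, x d ≤ c M)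
    (h2 : ∀ M, ∀ᶠ d in Filter.atTop, c M - τ M - ε d ≤ x d) :
    Filter.Tendsto x Filter.atTop (nhds L) := by
  rw [tendsto_order]
  refine ⟨fun a ha => ?_, fun a ha => ?_⟩
  · have h3 := (hc.sub hτ).eventually_const_lt (show (a + L) / 2 < L - 0 by linarith)
    obtain ⟨M, hM⟩ := h3.exists
    filter_upwards [h2 M, hε.eventually_lt_const (show 0 < (L - a) / 2 by linarith)] with d h4 h5
    linarith
  · obtain ⟨M, hM⟩ := (hc.eventually_lt_const ha).exists
    filter_upwards [h1 M] with d h4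
    linarith

section

variable {F : Type*} [Field F] {k : ℕ} {w : Fin k → ℕ} {v d : ℕ} {P : (MvPolynomial (Fin k) F)[X]}

lemma evalAt_reduce (m : F[X]) (x : PolyBox F w v d) :
    evalAt P (PolyBox.reduce w v d m x) = AdjoinRoot.mk m (evalAt P x.val) :=
  evalAt_comp P (AdjoinRoot.mkₐ (R := F) m) x.val

lemma squarefree_iff_forall_monic {a : F[X]} :
    Squarefree a ↔ ∀ π : F[X], π.Monic → Irreducible π → ¬ π ^ 2 ∣ a := by
  classical
  rw [squarefree_iff_irreducible_sq_not_dvd_of_exists_irreducible ⟨X, irreducible_X⟩]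
  refine ⟨fun h π _ hπ => by rw [sq]; exact h π hπ, fun h π hπ h1 => ?_⟩
  have h2 : Associated (normalize π) π := normalize_associated π
  refine h (normalize π) (monic_normalize hπ.ne_zero) (h2.irreducible_iff.2 hπ) ?_
  rw [sq]
  exact (h2.mul_mul h2).dvd.trans h1

lemma localDensity_nonneg (π : F[X]) : 0 ≤ localDensity P π := setDensity_nonneg _

variable [Finite F]

lemma localDensity_lt_one {x : (Fin k → F) × F} (hx : evalAt P x ≠ 0) {π : F[X]} (hm : π.Monic)
    (hπ : Irreducible π) : localDensity P π < 1 := by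
  have hfin : Finite (AdjoinRoot (π ^ 2)) := (hm.pow 2).finite_of_adjoinRoot
  have hnt : Nontrivial (AdjoinRoot (π ^ 2)) := by
    refine AdjoinRoot.nontrivial _ ?_
    rw [degree_eq_natDegree (hm.pow 2).ne_zero, natDegree_pow]
    have := hπ.natDegree_pos
    norm_cast
    lia
  set S := {x : (Fin k → AdjoinRoot (π ^ 2)) × AdjoinRoot (π ^ 2) | evalAt P x = 0} with hS
  have h1 : 0 < setDensity Sᶜ := by
    have h2 : (fun i => Algebra.ofId F (AdjoinRoot (π ^ 2)) (x.1 i),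
        Algebra.ofId F (AdjoinRoot (π ^ 2)) x.2) ∈ Sᶜ := by
      intro h
      rw [hS, Set.mem_ofPred_eq, evalAt_comp] at h
      exact hx ((map_eq_zero_iff _ (algebraMap F (AdjoinRoot (π ^ 2))).injective).1 h)
    have h3 : 0 < (Sᶜ).ncard := (Set.ncard_pos (Set.toFinite _)).2 ⟨_, h2⟩
    unfold setDensity
    have h4 : 0 < Nat.card ((Fin k → AdjoinRoot (π ^ 2)) × AdjoinRoot (π ^ 2)) := Nat.card_pos
    positivity
  rw [setDensity_compl] at h1
  exact sub_pos.1 h1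

lemma setDensity_sq_dvd (hw : ∀ i, 0 < w i) (hv : 0 < v) {π : F[X]} (hm : π.Monic)
    (hd : 2 * π.natDegree ≤ d) :
    setDensity {x : PolyBox F w v d | π ^ 2 ∣ evalAt P x.val} = localDensity P π := by
  unfold localDensity
  rw [← setDensity_preimage (PolyBox.reduce w v d (π ^ 2))
    (PolyBox.reduce_surjective hw hv (hm.pow 2) (by rwa [natDegree_pow]))]
  congr 1
  ext x
  simp [evalAt_reduce, AdjoinRoot.mk_eq_zero]

lemma setDensity_forall_not_sq_dvd (hw : ∀ i, 0 < w i) (hv : 0 < v) (S : Finset F[X])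
    (hS : ∀ π ∈ S, π.Monic ∧ Irreducible π) (hd : ∑ π ∈ S, 2 * π.natDegree ≤ d) :
    setDensity {x : PolyBox F w v d | ∀ π ∈ S, ¬ π ^ 2 ∣ evalAt P x.val} =
      ∏ π ∈ S, (1 - localDensity P π) := by
  have hco : Pairwise fun π π' : S => IsCoprime ((π : F[X]) ^ 2) ((π' : F[X]) ^ 2) := by
    intro π π' h
    refine IsCoprime.pow (((hS π π.2).2.coprime_iff_not_dvd).2 fun h1 => h (Subtype.ext ?_))
    exact eq_of_monic_of_associated (hS π π.2).1 (hS π' π'.2).1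
      (((hS π π.2).2.dvd_irreducible_iff_associated (hS π' π'.2).2).1 h1)
  have hdeg : (∏ π : S, (π : F[X]) ^ 2).natDegree ≤ d := by
    rw [natDegree_prod_of_monic _ _ fun (π : S) _ => (hS π π.2).1.pow 2]
    simp only [natDegree_pow]
    rwa [Finset.sum_coe_sort S fun π : F[X] => 2 * π.natDegree]
  have hfin (π : S) : Finite (AdjoinRoot ((π : F[X]) ^ 2)) :=
    ((hS π π.2).1.pow 2).finite_of_adjoinRoot
  rw [← Finset.prod_coe_sort S fun π => 1 - localDensity P π]
  have h1 := setDensity_preimage _ (PolyBox.reduce_pi_surjective hw hv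
    (fun π : S => (π : F[X]) ^ 2) (fun π => (hS π π.2).1.pow 2) hco hdeg)
    (Set.univ.pi fun π : S => {x | evalAt P x = 0}ᶜ)
  rw [setDensity_univ_pi] at h1
  simp only [setDensity_compl] at h1
  refine Eq.trans ?_ h1
  congr 1
  ext x
  simp [evalAt_reduce, AdjoinRoot.mk_eq_zero]

/-- The product of the local factors at the primes of degree `m`. -/
noncomputable def localFactor (P : (MvPolynomial (Fin k) F)[X]) (m : ℕ) : ℝ :=
  ∏ π ∈ (finite_monicIrreducibles F m).toFinset, (1 - localDensity P π)

lemma sum_localDensity_le (hP : P.Monic) {Δ : MvPolynomial (Fin k) F} (hΔ : Δ ≠ 0)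
    {U V : (MvPolynomial (Fin k) F)[X]} (hB : U * P + V * derivative P = C Δ) (m : ℕ) :
    ∑ π ∈ (finite_monicIrreducibles F m).toFinset, localDensity P π ≤
      ((P.natDegree * (1 + ∑ i, Δ.degreeOf i) : ℕ) : ℝ) * ((Nat.card F : ℝ)⁻¹) ^ m := by
  have hq : (0 : ℝ) < (Nat.card F : ℝ) ^ m := by
    have : 0 < Nat.card F := Nat.card_pos
    positivity
  set c := P.natDegree * (1 + ∑ i, Δ.degreeOf i)
  refine (Finset.sum_le_card_nsmul _ _ ((c : ℝ) / ((Nat.card F : ℝ) ^ m) ^ 2) fun π hπ => ?_).trans ?_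
  · rw [Set.Finite.mem_toFinset] at hπ
    have := localDensity_le hP hΔ hB hπ.1 hπ.2.1
    rwa [hπ.2.2] at this
  · rw [← Set.ncard_eq_toFinset_card _ (finite_monicIrreducibles F m), nsmul_eq_mul]
    have h1 : ((monicIrreducibles F m).ncard : ℝ) ≤ (Nat.card F : ℝ) ^ m := by
      exact_mod_cast ncard_monicIrreducibles_le F m
    refine (mul_le_mul_of_nonneg_right h1 (by positivity)).trans (le_of_eq ?_)
    rw [inv_pow]
    field_simp

/-- The monic irreducible polynomials of degree less than `M`. -/
noncomputable def monicIrreduciblesBelow (F : Type*) [Field F] [Finite F] (M : ℕ) : Finset F[X] :=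
  open Classical in (Finset.range M).biUnion fun m => (finite_monicIrreducibles F m).toFinset

lemma mem_monicIrreduciblesBelow {M : ℕ} {π : F[X]} :
    π ∈ monicIrreduciblesBelow F M ↔ π.Monic ∧ Irreducible π ∧ π.natDegree < M := by
  simp only [monicIrreduciblesBelow, monicIrreducibles, Finset.mem_biUnion, Finset.mem_range,
    Set.Finite.mem_toFinset, Set.mem_ofPred_eq]
  exact ⟨fun ⟨m, h, h1, h2, h3⟩ => ⟨h1, h2, h3 ▸ h⟩, fun ⟨h1, h2, h3⟩ => ⟨_, h3, h1, h2, rfl⟩⟩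

lemma prod_monicIrreduciblesBelow (M : ℕ) :
    ∏ π ∈ monicIrreduciblesBelow F M, (1 - localDensity P π) =
      ∏ m ∈ Finset.range M, localFactor P m := by
  classical
  unfold monicIrreduciblesBelow localFactor
  rw [Finset.prod_biUnion]
  intro m _ m' _ h
  rw [Function.onFun, Finset.disjoint_left]
  intro π h1 h2
  rw [Set.Finite.mem_toFinset] at h1 h2
  exact h (h1.2.2.symm.trans h2.2.2)

lemma setDensity_middle_le (hw : ∀ i, 0 < w i) (hv : 0 < v) (hP : P.Monic)
    {Δ : MvPolynomial (Fin k) F} (hΔ : Δ ≠ 0)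
    {U V : (MvPolynomial (Fin k) F)[X]} (hB : U * P + V * derivative P = C Δ) (M : ℕ) :
    setDensity {x : PolyBox F w v d | ∃ π : F[X], π.Monic ∧ Irreducible π ∧ M ≤ π.natDegree ∧
        2 * π.natDegree ≤ d ∧ π ^ 2 ∣ evalAt P x.val} ≤
      ((P.natDegree * (1 + ∑ i, Δ.degreeOf i) : ℕ) : ℝ) *
        ((Nat.card F : ℝ)⁻¹ ^ M / (1 - (Nat.card F : ℝ)⁻¹)) := by
  have hq : (1 : ℝ) < Nat.card F := by exact_mod_cast Finite.one_lt_card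
  refine (setDensity_mono (T := ⋃ m ∈ Finset.Ico M (d / 2 + 1),
    ⋃ π ∈ (finite_monicIrreducibles F m).toFinset, {x | π ^ 2 ∣ evalAt P x.val}) ?_).trans ?_
  · rintro x ⟨π, h1, h2, h3, h4, h5⟩
    simp only [Set.mem_iUnion, exists_prop, Finset.mem_Ico, Set.Finite.mem_toFinset]
    exact ⟨π.natDegree, ⟨h3, by lia⟩, π, ⟨h1, h2, rfl⟩, h5⟩
  refine (setDensity_biUnion_le _ _).trans ?_
  refine (Finset.sum_le_sum (g := fun m => ((P.natDegree * (1 + ∑ i, Δ.degreeOf i) : ℕ) : ℝ) *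
    ((Nat.card F : ℝ)⁻¹) ^ m) fun m hm => ?_).trans ?_
  · refine (setDensity_biUnion_le _ _).trans (le_trans (le_of_eq ?_) (sum_localDensity_le hP hΔ hB m))
    refine Finset.sum_congr rfl fun π hπ => setDensity_sq_dvd hw hv ?_ ?_
    · exact ((Set.Finite.mem_toFinset _).1 hπ).1
    · rw [((Set.Finite.mem_toFinset _).1 hπ).2.2]
      have := (Finset.mem_Ico.1 hm).2
      lia
  · rw [← Finset.mul_sum]
    exact mul_le_mul_of_nonneg_left (geom_sum_Ico_le_of_lt_one (by positivity)
      (inv_lt_one_of_one_lt₀ hq)) (Nat.cast_nonneg _)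

lemma tendsto_large_bound {p : ℕ} (hp : 0 < p) {q : ℝ} (hq : 1 < q) (c : ℝ) :
    Filter.Tendsto (fun d : ℕ => c * (((d - 1) / p + 1 : ℕ) / q ^ ((d - 1) / p + 1)))
      Filter.atTop (nhds 0) := by
  have h1 := tendsto_self_mul_const_pow_of_lt_one (r := q⁻¹) (by positivity)
    (inv_lt_one_of_one_lt₀ hq)
  have h2 : Filter.Tendsto (fun d : ℕ => (d - 1) / p + 1) Filter.atTop Filter.atTop :=
    (Filter.tendsto_add_atTop_nat 1).comp
      ((Nat.tendsto_div_const_atTop hp.ne').comp (Filter.tendsto_sub_atTop_nat 1))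
  have h3 := (h1.comp h2).const_mul c
  rw [mul_zero] at h3
  refine h3.congr fun d => ?_
  simp [div_eq_mul_inv]

theorem exists_tendsto_setDensity_squarefree {p : ℕ} [Fact p.Prime] [CharP F p] (hw : ∀ i, 0 < w i)
    (hv : 0 < v) (hP : P.Monic) (hr : P.natDegree ≠ 0) {Δ : MvPolynomial (Fin k) F} (hΔ : Δ ≠ 0)
    {U V : (MvPolynomial (Fin k) F)[X]} (hB : U * P + V * derivative P = C Δ)
    {x₀ : (Fin k → F) × F} (hx₀ : evalAt P x₀ ≠ 0) :
    ∃ L : ℝ, 0 < L ∧ Filter.Tendsto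
      (fun d => setDensity {x : PolyBox F w v d | Squarefree (evalAt P x.val)})
      Filter.atTop (nhds L) := by
  have hq : (1 : ℝ) < Nat.card F := by exact_mod_cast Finite.one_lt_card
  have ht0 : 0 ≤ (Nat.card F : ℝ)⁻¹ := by positivity
  have ht1 : (Nat.card F : ℝ)⁻¹ < 1 := inv_lt_one_of_one_lt₀ hq
  have hlt (m : ℕ) (π) (hπ : π ∈ (finite_monicIrreducibles F m).toFinset) : localDensity P π < 1 :=
    have h := (Set.Finite.mem_toFinset _).1 hπ
    localDensity_lt_one hx₀ h.1 h.2.1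
  obtain ⟨L, hL0, hL, -⟩ := exists_tendsto_prod_pos (b := localFactor P) ht0 ht1
    (fun m => Finset.prod_pos fun π hπ => sub_pos.2 (hlt m π hπ))
    (fun m => Finset.prod_le_one (fun π hπ => sub_nonneg.2 (hlt m π hπ).le)
      fun π _ => sub_le_self _ (localDensity_nonneg π))
    (fun m => (sub_le_sub_left (sum_localDensity_le hP hΔ hB m) 1).trans
      (one_sub_sum_le_prod_one_sub _ _ (fun π _ => localDensity_nonneg π)
        fun π hπ => (hlt m π hπ).le))
  obtain ⟨c, hc⟩ := exists_setDensity_large_le (p := p) hw hv hP hr hΔ hB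
  have hS (M : ℕ) (π) (hπ : π ∈ monicIrreduciblesBelow F M) : π.Monic ∧ Irreducible π :=
    have h := mem_monicIrreduciblesBelow.1 hπ
    ⟨h.1, h.2.1⟩
  refine ⟨L, hL0, tendsto_of_sandwich hL (tendsto_const_mul_pow_div ht0 ht1
    ((P.natDegree * (1 + ∑ i, Δ.degreeOf i) : ℕ) : ℝ))
    (tendsto_large_bound (Fact.out : p.Prime).pos hq c) (fun M => ?_) fun M => ?_⟩
  · filter_upwards [Filter.eventually_ge_atTop
      (∑ π ∈ monicIrreduciblesBelow F M, 2 * π.natDegree)] with d hd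
    rw [← prod_monicIrreduciblesBelow, ← setDensity_forall_not_sq_dvd hw hv _ (hS M) hd]
    exact setDensity_mono fun x hx π hπ =>
      squarefree_iff_forall_monic.1 hx π (hS M π hπ).1 (hS M π hπ).2
  · filter_upwards [Filter.eventually_ge_atTop
      (∑ π ∈ monicIrreduciblesBelow F M, 2 * π.natDegree), Filter.eventually_ge_atTop 1] with d hd hd1
    rw [← prod_monicIrreduciblesBelow, ← setDensity_forall_not_sq_dvd hw hv _ (hS M) hd,
      sub_sub, sub_le_iff_le_add]
    refine (setDensity_mono ?_).trans ((setDensity_union_le _ _).trans (add_le_add_right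
      ((setDensity_union_le _ _).trans
        (add_le_add (setDensity_middle_le hw hv hP hΔ hB M) (hc d hd1))) _))
    intro x hx
    by_cases h : Squarefree (evalAt P x.val)
    · exact Or.inl h
    · rw [squarefree_iff_forall_monic] at h
      push Not at h
      obtain ⟨π, h1, h2, h3⟩ := h
      right
      by_cases h4 : d < 2 * π.natDegree
      · exact Or.inr ⟨π, h1, h2, h4, h3⟩
      · refine Or.inl ⟨π, h1, h2, ?_, by lia, h3⟩
        by_contra h5
        exact hx π (mem_monicIrreduciblesBelow.2 ⟨h1, h2, by lia⟩) h3

end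

/-! ### The discriminant of the generic polynomial -/

section

variable {R : Type*} [CommRing R] {k : ℕ}

/-- The polynomial `X ^ (k + 1) + g₀ X ^ k + ⋯ + g_{k-1} X`. -/
noncomputable def basePoly (g : Fin k → R) : R[X] :=
  X ^ (k + 1) + ∑ i : Fin k, C (g i) * X ^ (k - (i : ℕ))

/-- The polynomial `X ^ (k + 1) + g₀ X ^ k + ⋯ + g_{k-1} X + y`. -/
noncomputable def genericPoly (g : Fin k → R) (y : R) : R[X] := basePoly g + C y

lemma degree_basePoly_tail_lt (g : Fin k → R) :
    (∑ i : Fin k, C (g i) * X ^ (k - (i : ℕ))).degree < ((k + 1 : ℕ) : WithBot ℕ) := by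
  refine (degree_sum_le _ _).trans_lt ((Finset.sup_lt_iff (WithBot.bot_lt_coe _)).2 fun i _ => ?_)
  refine (degree_C_mul_X_pow_le _ _).trans_lt ?_
  norm_cast
  lia

lemma monic_basePoly (g : Fin k → R) : (basePoly g).Monic :=
  monic_X_pow_add (degree_basePoly_tail_lt g)

lemma natDegree_basePoly [Nontrivial R] (g : Fin k → R) : (basePoly g).natDegree = k + 1 := by
  unfold basePoly
  rw [natDegree_add_eq_left_of_degree_lt, natDegree_X_pow]
  rw [degree_X_pow]
  exact degree_basePoly_tail_lt g

lemma natDegree_genericPoly [Nontrivial R] (g : Fin k → R) (y : R) :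
    (genericPoly g y).natDegree = k + 1 := by
  rw [genericPoly, natDegree_add_C, natDegree_basePoly]

lemma derivative_genericPoly (g : Fin k → R) (y : R) :
    derivative (genericPoly g y) = derivative (basePoly g) := by
  simp [genericPoly]

lemma natDegree_derivative_basePoly [Nontrivial R] (hk : ((k + 1 : ℕ) : R) ≠ 0) (g : Fin k → R) :
    (derivative (basePoly g)).natDegree = k ∧
      (derivative (basePoly g)).leadingCoeff = ((k + 1 : ℕ) : R) := by
  have h1 : (derivative (basePoly g)).coeff k = ((k + 1 : ℕ) : R) := by
    have := (monic_basePoly g).coeff_natDegree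
    rw [natDegree_basePoly] at this
    rw [coeff_derivative, this]
    simp
  have h2 : (derivative (basePoly g)).natDegree = k := by
    refine natDegree_eq_of_le_of_coeff_ne_zero ?_ (by rwa [h1])
    simpa [natDegree_basePoly] using natDegree_derivative_le (basePoly g)
  exact ⟨h2, by rw [leadingCoeff, h2, h1]⟩

lemma map_genericPoly {S : Type*} [CommRing S] (φ : R →+* S) (g : Fin k → R) (y : R) :
    (genericPoly g y).map φ = genericPoly (fun i => φ (g i)) (φ y) := by
  simp [genericPoly, basePoly, Polynomial.map_sum]

/-- The resultant of `genericPoly g y` and its derivative. -/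
noncomputable def genericResultant (g : Fin k → R) (y : R) : R :=
  resultant (genericPoly g y) (derivative (genericPoly g y)) (k + 1) k

lemma map_genericResultant {S : Type*} [CommRing S] (φ : R →+* S) (g : Fin k → R) (y : R) :
    φ (genericResultant g y) = genericResultant (fun i => φ (g i)) (φ y) := by
  unfold genericResultant
  rw [← resultant_map_map, ← derivative_map, map_genericPoly]

end

lemma genericResultant_X_eq_prod {L : Type*} [Field L] [IsAlgClosed L] {k : ℕ}
    (hk : ((k + 1 : ℕ) : L) ≠ 0) (g : Fin k → L) :
    genericResultant (fun i => (C (g i) : L[X])) X = C (((k + 1 : ℕ) : L) ^ (k + 1)) *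
      (((derivative (basePoly g)).roots.map fun c => -eval c (basePoly g)).map
        fun a => X - C a).prod := by
  have hbase : basePoly (fun i => (C (g i) : L[X])) = (basePoly g).map C := by
    simp [basePoly, Polynomial.map_sum]
  obtain ⟨h1, h2⟩ := natDegree_derivative_basePoly hk g
  have hs : (derivative (basePoly g)).Splits := IsAlgClosed.splits _
  have h3 := resultant_eq_prod_eval ((derivative (basePoly g)).map C)
    (genericPoly (fun i => (C (g i) : L[X])) X) (k + 1) (natDegree_genericPoly _ _).le (hs.map C)
  rw [natDegree_map_eq_of_injective C_injective, h1, leadingCoeff_map_of_injective C_injective, h2,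
    hs.roots_map C] at h3
  rw [genericResultant, derivative_genericPoly, hbase, derivative_map, resultant_comm, h3,
    mul_comm (k + 1) k, (Nat.even_mul_succ_self k).neg_one_pow, one_mul, C_pow, Multiset.map_map,
    Multiset.map_map]
  congr 3
  ext1 c
  simp [genericPoly, hbase, add_comm]

section

variable {F : Type*} [Field F] {k : ℕ}

/-- The discriminant, up to a unit, of the generic polynomial of degree `k + 1` over `F`, as a
monic polynomial in the constant coefficient. -/
noncomputable def genericDisc (F : Type*) [Field F] (k : ℕ) : (MvPolynomial (Fin k) F)[X] :=
  C (MvPolynomial.C (((k + 1 : ℕ) : F) ^ (k + 1))⁻¹) *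
    genericResultant (fun i => (C (MvPolynomial.X i) : (MvPolynomial (Fin k) F)[X])) X

lemma map_genericDisc {L : Type*} [Field L] [IsAlgClosed L] (hk : ((k + 1 : ℕ) : F) ≠ 0)
    (ψ : MvPolynomial (Fin k) F →+* L) :
    (genericDisc F k).map ψ = (((derivative (basePoly fun i => ψ (MvPolynomial.X i))).roots.map
      fun c => -eval c (basePoly fun i => ψ (MvPolynomial.X i))).map fun a => X - C a).prod := by
  have hk' : ((k + 1 : ℕ) : L) ≠ 0 := by
    have := (map_ne_zero_iff _ (ψ.comp MvPolynomial.C).injective).2 hk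
    simpa using this
  have h1 := map_genericResultant (mapRingHom ψ)
    (fun i : Fin k => (C (MvPolynomial.X i) : (MvPolynomial (Fin k) F)[X])) X
  simp only [coe_mapRingHom, map_C, map_X] at h1
  rw [genericDisc, Polynomial.map_mul, h1, genericResultant_X_eq_prod hk', ← mul_assoc, map_C,
    ← C_mul]
  have h2 : ψ (MvPolynomial.C (((k + 1 : ℕ) : F) ^ (k + 1))⁻¹) * ((k + 1 : ℕ) : L) ^ (k + 1) = 1 := by
    have h3 : ψ (MvPolynomial.C (((k + 1 : ℕ) : F) ^ (k + 1))) = ((k + 1 : ℕ) : L) ^ (k + 1) := by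
      simp
    rw [← h3, ← map_mul, ← map_mul, inv_mul_cancel₀ (pow_ne_zero _ hk), map_one, map_one]
  rw [h2, C_1, one_mul]

lemma monic_genericDisc (hk : ((k + 1 : ℕ) : F) ≠ 0) :
    (genericDisc F k).Monic ∧ (genericDisc F k).natDegree = k := by
  let S := MvPolynomial (Fin k) F
  let K := FractionRing S
  let ψ : S →+* AlgebraicClosure K := (algebraMap K _).comp (algebraMap S K)
  have hψ : Function.Injective ψ := (algebraMap K _).injective.comp (IsFractionRing.injective S K)
  have hk' : ((k + 1 : ℕ) : AlgebraicClosure K) ≠ 0 := by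
    have := (map_ne_zero_iff _ (ψ.comp MvPolynomial.C).injective).2 hk
    simpa using this
  have h := map_genericDisc hk ψ
  constructor
  · refine monic_of_injective hψ ?_
    rw [h]
    exact monic_multiset_prod_of_monic _ _ fun a _ => monic_X_sub_C a
  · rw [← natDegree_map_eq_of_injective hψ, h, natDegree_multiset_prod_X_sub_C_eq_card,
      Multiset.card_map, ← (IsAlgClosed.splits _).natDegree_eq_card_roots,
      (natDegree_derivative_basePoly hk' _).1]

lemma evalAt_genericDisc {R : Type*} [CommRing R] [Algebra F R] (x : (Fin k → R) × R) :
    evalAt (genericDisc F k) x =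
      algebraMap F R (((k + 1 : ℕ) : F) ^ (k + 1))⁻¹ * genericResultant x.1 x.2 := by
  have h1 := map_genericResultant (eval₂RingHom (MvPolynomial.aeval x.1).toRingHom x.2)
    (fun i : Fin k => (C (MvPolynomial.X i) : (MvPolynomial (Fin k) F)[X])) X
  simp only [coe_eval₂RingHom, eval₂_C, eval₂_X] at h1
  rw [evalAt, specialize, eval_map, genericDisc, eval₂_mul, h1, eval₂_C]
  simp

lemma evalAt_genericDisc_ne_zero (hk : ((k + 1 : ℕ) : F) ≠ 0) :
    evalAt (genericDisc F k) ((fun _ => 0, 1) : (Fin k → F) × F) ≠ 0 := by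
  intro h
  let L := AlgebraicClosure F
  have hk' : ((k + 1 : ℕ) : L) ≠ 0 := by
    have := (map_ne_zero_iff _ (algebraMap F L).injective).2 hk
    simpa using this
  have h1 := evalAt_comp (genericDisc F k) (Algebra.ofId F L) ((fun _ => 0, 1) : (Fin k → F) × F)
  rw [h, map_zero] at h1
  simp only [map_zero, map_one] at h1
  rw [evalAt, specialize, map_genericDisc hk, eval_multiset_prod, Multiset.prod_eq_zero_iff] at h1
  simp only [Multiset.map_map, Multiset.mem_map, Function.comp_apply] at h1
  obtain ⟨c, hc, hc'⟩ := h1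
  have hbase : (basePoly fun i : Fin k =>
      (MvPolynomial.aeval (R := F) (fun _ : Fin k => (0 : L))).toRingHom (MvPolynomial.X i)) =
        X ^ (k + 1) := by
    simp [basePoly]
  rw [hbase] at hc hc'
  have h2 := (mem_roots'.1 hc).2
  simp only [derivative_X_pow, IsRoot.def, eval_mul, eval_C, eval_pow, eval_X, add_tsub_cancel_right,
    mul_eq_zero, hk', false_or] at h2
  simp only [eval_sub, eval_X, eval_C, eval_pow, sub_neg_eq_add] at hc'
  rw [pow_succ, h2] at hc'
  simp at hc'

end

lemma basePoly_single {L : Type*} [Field L] (j : ℕ) :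
    basePoly (Pi.single (Fin.last j) (-((j + 1 + 1 : ℕ) : L))) =
      X ^ (j + 1 + 1) - C ((j + 1 + 1 : ℕ) : L) * X := by
  unfold basePoly
  rw [Finset.sum_eq_single (Fin.last j)]
  · rw [Pi.single_eq_same, Fin.val_last, add_tsub_cancel_left, pow_one, C_neg, neg_mul,
      sub_eq_add_neg]
  · intro i _ hi
    rw [Pi.single_eq_of_ne hi, C_0, zero_mul]
  · simp

lemma separable_criticalValues {L : Type*} [Field L] [IsAlgClosed L] {j : ℕ}
    (hk : ((j + 1 + 1 : ℕ) : L) ≠ 0) (hk' : ((j + 1 : ℕ) : L) ≠ 0) :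
    (((derivative (X ^ (j + 1 + 1) - C ((j + 1 + 1 : ℕ) : L) * X)).roots.map
      fun c => -eval c (X ^ (j + 1 + 1) - C ((j + 1 + 1 : ℕ) : L) * X)).map
        fun a => X - C a).prod.Separable := by
  rw [← nodup_roots_iff_of_splits (monic_multiset_prod_of_monic _ _ fun a _ => monic_X_sub_C a).ne_zero
    (IsAlgClosed.splits _), roots_multiset_prod_X_sub_C]
  have h1 : derivative (X ^ (j + 1 + 1) - C ((j + 1 + 1 : ℕ) : L) * X) =
      C ((j + 1 + 1 : ℕ) : L) * (X ^ (j + 1) - 1) := by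
    rw [derivative_sub, derivative_X_pow, derivative_C_mul, derivative_X, add_tsub_cancel_right,
      mul_sub]
  rw [h1, roots_C_mul _ hk]
  refine Multiset.Nodup.map_on (fun c hc c' hc' h => ?_)
    (nodup_roots (X_pow_sub_one_separable_iff.2 hk'))
  have key : ∀ c ∈ (X ^ (j + 1) - 1 : L[X]).roots,
      -eval c (X ^ (j + 1 + 1) - C ((j + 1 + 1 : ℕ) : L) * X) = ((j + 1 : ℕ) : L) * c := by
    intro c hc
    have h2 : c ^ (j + 1) = 1 := by simpa [sub_eq_zero] using (mem_roots'.1 hc).2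
    simp only [eval_sub, eval_pow, eval_X, eval_mul, eval_C]
    rw [pow_succ, h2]
    push_cast
    ring
  rw [key c hc, key c' hc'] at h
  exact mul_left_cancel₀ hk' h

lemma exists_bezout_genericDisc {F : Type*} [Field F] {k : ℕ} (hk : ((k + 1 : ℕ) : F) ≠ 0)
    (hk' : (k : F) ≠ 0) : ∃ Δ : MvPolynomial (Fin k) F, Δ ≠ 0 ∧
      ∃ U V, U * genericDisc F k + V * derivative (genericDisc F k) = C Δ := by
  obtain ⟨j, rfl⟩ : ∃ j, k = j + 1 := Nat.exists_eq_succ_of_ne_zero (by rintro rfl; simp at hk')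
  obtain ⟨hm, hd⟩ := monic_genericDisc hk
  set P := genericDisc F (j + 1) with hP
  obtain ⟨U, V, -, -, hUV⟩ := exists_mul_add_mul_eq_C_resultant P (derivative P)
    (m := P.natDegree) (n := P.natDegree) le_rfl
    ((natDegree_derivative_le P).trans (Nat.sub_le _ _)) (Or.inl (by lia))
  refine ⟨_, fun h0 => ?_, U, V, by rw [← hUV, mul_comm U, mul_comm V]⟩
  let L := AlgebraicClosure F
  have hL : ((j + 1 + 1 : ℕ) : L) ≠ 0 := by
    have := (map_ne_zero_iff _ (algebraMap F L).injective).2 hk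
    simpa using this
  have hL' : ((j + 1 : ℕ) : L) ≠ 0 := by
    have := (map_ne_zero_iff _ (algebraMap F L).injective).2 hk'
    simpa using this
  let ψ : MvPolynomial (Fin (j + 1)) F →+* L :=
    (MvPolynomial.aeval (R := F) (Pi.single (Fin.last j) (-((j + 1 + 1 : ℕ) : L)))).toRingHom
  have hψ : (fun i => ψ (MvPolynomial.X i)) = Pi.single (Fin.last j) (-((j + 1 + 1 : ℕ) : L)) := by
    funext i
    simp [ψ]
  have h1 := map_genericDisc hk ψ
  rw [hψ, basePoly_single] at h1
  refine not_isCoprime_of_resultant_eq_zero (hm.map ψ) (q := derivative (P.map ψ))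
    ((natDegree_derivative_le _).trans (Nat.sub_le _ _)) ?_ ?_
  · rw [hm.natDegree_map, derivative_map, resultant_map_map, h0, map_zero]
  · have h2 := separable_criticalValues hL hL'
    rw [← h1] at h2
    exact h2

lemma polyRes_eq_resultant {R : Type*} [CommRing R] (p q : R[X]) :
    polyRes p q = resultant p q p.natDegree q.natDegree := by
  rw [resultant, ← Matrix.det_transpose, polyRes,
    ← Matrix.det_submatrix_equiv_self Fin.revPerm (Matrix.transpose _)]
  congr 1
  ext i j
  simp only [sylvesterMatrix, Matrix.of_apply, Matrix.submatrix_apply, Matrix.transpose_apply,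
    sylvester, Fin.revPerm_apply]
  have hi := i.isLt
  have hj := j.isLt
  by_cases h : (i : ℕ) < q.natDegree
  · have hc : Fin.rev i = Fin.natAdd p.natDegree ⟨q.natDegree - 1 - i, by omega⟩ := by
      ext; simp only [Fin.val_rev, Fin.val_natAdd]; omega
    rw [hc, Fin.addCases_right, if_pos h]
    simp only [Fin.val_rev, Set.mem_Icc]
    by_cases h' : (i : ℕ) ≤ j ∧ (j : ℕ) ≤ i + p.natDegree
    · rw [if_pos h', if_pos (by omega)]
      congr 1; omega
    · rw [if_neg h', if_neg (by omega)]
  · have hc : Fin.rev i = Fin.castAdd q.natDegree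
        ⟨p.natDegree + q.natDegree - 1 - i, by omega⟩ := by
      ext; simp only [Fin.val_rev, Fin.val_castAdd]; omega
    rw [hc, Fin.addCases_left, if_neg h]
    simp only [Fin.val_rev, Set.mem_Icc]
    by_cases h' : (i : ℕ) - q.natDegree ≤ j ∧ (j : ℕ) ≤ i
    · rw [if_pos h', if_pos (by omega)]
      congr 1; omega
    · rw [if_neg h', if_neg (by omega)]

lemma squarefree_polyDisc_genericPoly_iff {F : Type*} [Field F] {k : ℕ}
    (hk : ((k + 1 : ℕ) : F) ≠ 0) (g : Fin k → F[X]) (y : F[X]) :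
    Squarefree (polyDisc (genericPoly g y)) ↔ Squarefree (evalAt (genericDisc F k) (g, y)) := by
  have hk' : ((k + 1 : ℕ) : F[X]) ≠ 0 := by
    have := (map_ne_zero_iff _ (C_injective (R := F))).2 hk
    simpa using this
  have h1 : polyRes (genericPoly g y) (derivative (genericPoly g y)) = genericResultant g y := by
    rw [polyRes_eq_resultant, genericResultant, natDegree_genericPoly, derivative_genericPoly,
      (natDegree_derivative_basePoly hk' g).1]
  rw [polyDisc, h1, evalAt_genericDisc]
  refine Associated.squarefree_iff (Associated.trans (y := genericResultant g y) ?_ ?_)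
  · exact associated_unit_mul_left _ _ (isUnit_one.neg.pow _)
  · exact (associated_unit_mul_left _ _
      ((IsUnit.mk0 _ (inv_ne_zero (pow_ne_zero _ hk))).map (algebraMap F F[X]))).symm

lemma X_pow_add_sum_eq_genericPoly {R : Type*} [CommRing R] {k : ℕ} (a : Fin (k + 1) → R) :
    X ^ (k + 1) + ∑ i : Fin (k + 1), C (a i) * X ^ (k + 1 - ((i : ℕ) + 1)) =
      genericPoly (fun i => a i.castSucc) (a (Fin.last k)) := by
  simp [genericPoly, basePoly, Fin.sum_univ_castSucc, add_assoc]

lemma natCard_polyBox (F : Type*) [Field F] {k : ℕ} (w : Fin k → ℕ) (v d : ℕ) :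
    Nat.card (PolyBox F w v d) = Nat.card F ^ (∑ i, (w i * d + 1) + (v * d + 1)) := by
  rw [Nat.card_prod, Nat.card_pi]
  simp_rw [natCard_degreeLT]
  rw [Finset.prod_pow_eq_pow_sum, ← pow_add]

lemma sum_succ_mul_add_one (k d : ℕ) :
    ∑ i : Fin k, (((i : ℕ) + 1) * d + 1) + ((k + 1) * d + 1) =
      k + 1 + d * (k + 1) * (k + 1 + 1) / 2 := by
  have h : ∀ m : ℕ, 2 * ∑ i : Fin m, (((i : ℕ) + 1) * d + 1) = 2 * m + d * m * (m + 1) := by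
    intro m
    induction m with
    | zero => simp
    | succ m ih =>
      rw [Fin.sum_univ_castSucc, mul_add]
      simp only [Fin.val_castSucc, Fin.val_last, ih]
      ring
  have h1 := h (k + 1)
  rw [Fin.sum_univ_castSucc] at h1
  simp only [Fin.val_castSucc, Fin.val_last] at h1
  omega

/-- Families of polynomials with `deg (a i) ≤ (i + 1) d`, their last member split off. -/
noncomputable def polyBoxEquiv (F : Type*) [Field F] (k d : ℕ) :
    {a : Fin (k + 1) → F[X] // ∀ i, (a i).natDegree ≤ ((i : ℕ) + 1) * d} ≃
      PolyBox F (fun i : Fin k => (i : ℕ) + 1) (k + 1) d where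
  toFun a := (fun i => ⟨a.1 i.castSucc, mem_degreeLT_succ_iff.2 (a.2 i.castSucc)⟩,
    ⟨a.1 (Fin.last k), mem_degreeLT_succ_iff.2 (a.2 (Fin.last k))⟩)
  invFun x := ⟨Fin.snoc (fun i => (x.1 i : F[X])) (x.2 : F[X]), fun i => by
    induction i using Fin.lastCases with
    | last => simpa using mem_degreeLT_succ_iff.1 x.2.2
    | cast i => simpa using mem_degreeLT_succ_iff.1 (x.1 i).2⟩
  left_inv a := by
    ext1
    exact Fin.snoc_init_self a.1
  right_inv x := by
    ext <;> simp

lemma natCard_squarefree_polyDisc {F : Type*} [Field F] {k : ℕ}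
    (hk : ((k + 1 : ℕ) : F) ≠ 0) (d : ℕ) :
    Nat.card {a : Fin (k + 1) → F[X] //
      (∀ i : Fin (k + 1), (a i).natDegree ≤ ((i : ℕ) + 1) * d) ∧
      Squarefree (polyDisc ((X : F[X][X]) ^ (k + 1)
        + ∑ i : Fin (k + 1), C (a i) * X ^ (k + 1 - ((i : ℕ) + 1))))} =
    {x : PolyBox F (fun i : Fin k => (i : ℕ) + 1) (k + 1) d |
      Squarefree (evalAt (genericDisc F k) x.val)}.ncard := by
  rw [← Nat.card_coe_set_eq]
  refine Nat.card_congr ((Equiv.subtypeSubtypeEquivSubtypeInter _ _).symm.trans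
    ((polyBoxEquiv F k d).subtypeEquiv fun a => ?_))
  rw [X_pow_add_sum_eq_genericPoly, squarefree_polyDisc_genericPoly_iff hk]
  rfl

/-- **Positive density of squarefree discriminants over `𝔽_q[t]`.**
Let `n > 1`, let `p` be a prime not dividing `n * (n - 1)`, and let `F` be a
finite field of characteristic `p` with `q` elements (so `q` is a power of
`p`), `A = F[t]`. For `d : ℕ`, among the `D d = q ^ (n + d * n * (n+1) / 2)`
tuples `(a_1, …, a_n) ∈ A ^ n` with `deg (a_i) ≤ i * d`, let `N d` be the
number of those for which `disc (x^n + a_1 x^(n-1) + ⋯ + a_n) ∈ A` is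
squarefree. Then `N d / D d` converges, as `d → ∞`, to a strictly positive
limit. -/
theorem squarefree_discriminant_density
    (n : ℕ) (hn : 1 < n) (p q : ℕ) (hp : p.Prime) (hnd : ¬ p ∣ n * (n - 1))
    (F : Type) [Field F] [Fintype F] (hcharF : CharP F p) (hcard : Fintype.card F = q) :
    ∃ L : ℝ, 0 < L ∧
      Filter.Tendsto
        (fun d : ℕ =>
          ((Nat.card {a : Fin n → Polynomial F //
              (∀ i : Fin n, (a i).natDegree ≤ ((i : ℕ) + 1) * d) ∧
              Squarefree (polyDisc
                ((Polynomial.X : Polynomial (Polynomial F)) ^ n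
                  + ∑ i : Fin n,
                      Polynomial.C (a i) * Polynomial.X ^ (n - ((i : ℕ) + 1))))}) : ℝ)
            / (q : ℝ) ^ (n + d * n * (n + 1) / 2))
        Filter.atTop (nhds L) := by
  obtain ⟨k, rfl⟩ : ∃ k, n = k + 1 := ⟨n - 1, by omega⟩
  rw [add_tsub_cancel_right] at hnd
  have : Fact p.Prime := ⟨hp⟩
  have hk : ((k + 1 : ℕ) : F) ≠ 0 := fun h =>
    hnd (Dvd.dvd.mul_right ((CharP.cast_eq_zero_iff F p _).1 h) _)
  have hk' : (k : F) ≠ 0 := fun h =>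
    hnd (Dvd.dvd.mul_left ((CharP.cast_eq_zero_iff F p _).1 h) _)
  obtain ⟨hP, hdeg⟩ := monic_genericDisc hk
  obtain ⟨Δ, hΔ, U, V, hB⟩ := exists_bezout_genericDisc hk hk'
  obtain ⟨L, hL, hlim⟩ := exists_tendsto_setDensity_squarefree (p := p)
    (w := fun i : Fin k => (i : ℕ) + 1) (v := k + 1) (fun i => i.val.succ_pos) k.succ_pos hP
    (by omega) hΔ hB (evalAt_genericDisc_ne_zero hk)
  refine ⟨L, hL, hlim.congr fun d => ?_⟩
  rw [setDensity, natCard_squarefree_polyDisc hk, natCard_polyBox, sum_succ_mul_add_one,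
    Nat.card_eq_fintype_card, hcard, Nat.cast_pow]
end
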